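/- arXiv:1001.4569 — 3 statements merged into one kernel-verified Lean document; each statement's English description precedes it below -/
import Mathlib

section
/- Let (M^n, E, ⟨,⟩, D, ξ, ζ) be a frontal bundle over a 1-connected manifold M^n (n ≥ 3) satisfying the Gauss equation ⟨R^D(X,Y)v, w⟩ = det[⟨ξ(Y),v⟩, ⟨ξ(Y),w⟩; ⟨ζ(X),v⟩, ⟨ζ(X),w⟩] + det[⟨ζ(Y),v⟩, ⟨ζ(Y),w⟩; ⟨ξ(X),v⟩, ⟨ξ(X),w⟩], and suppose the regular set R_M of ξ is dense in M^n. Then the first fundamental form g = ξ*⟨,⟩ is a conformally flat metric on R_M, the Schouten tensor A of g equals −II (minus the second fundamental form of the frontal bundle), and the third fundamental form ǧ = ζ*⟨,⟩ satisfies ǧ_{ij} = Σ_{a,b} A_{ia} g^{ab} A_{bj}. -/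
noncomputable section

namespace Loc

open Matrix

variable {n : ℕ}

/-- Points of the local coordinate chart `ℝⁿ`. -/
abbrev Pt (n : ℕ) := Fin n → ℝ

/-- `n × n` real matrices. -/
abbrev Mat (n : ℕ) := Matrix (Fin n) (Fin n) ℝ

/-- `i`-th partial derivative of a scalar function on `ℝⁿ`. -/
def pd (i : Fin n) (f : Pt n → ℝ) (p : Pt n) : ℝ :=
  fderiv ℝ f p (Pi.single i 1)

/-- Christoffel symbols `Γ^k_{ij}` of a metric `g` (as a matrix-valued function). -/
def christoffel (g : Pt n → Mat n) (k i j : Fin n) (p : Pt n) : ℝ :=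
  (1 / 2) * ∑ l, (g p)⁻¹ k l *
    (pd i (fun q => g q j l) p + pd j (fun q => g q i l) p - pd l (fun q => g q i j) p)

/-- Curvature tensor `R^l{}_{kij}` of `g`, i.e. `R(∂ᵢ,∂ⱼ)∂ₖ = Σ_l riemann g l i j k • ∂_l`. -/
def riemann (g : Pt n → Mat n) (l i j k : Fin n) (p : Pt n) : ℝ :=
  pd i (christoffel g l j k) p - pd j (christoffel g l i k) p
    + ∑ m, (christoffel g l i m p * christoffel g m j k p
      - christoffel g l j m p * christoffel g m i k p)

/-- Ricci tensor `R_{jk}` of `g`. -/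
def ricci (g : Pt n → Mat n) (j k : Fin n) (p : Pt n) : ℝ :=
  ∑ i, riemann g i i j k p

/-- Scalar curvature `S_g`. -/
def scalarCurv (g : Pt n → Mat n) (p : Pt n) : ℝ :=
  ∑ j, ∑ k, (g p)⁻¹ j k * ricci g j k p

/-- The Schouten tensor `A = (1/(n-2)) (Ric - S_g/(2(n-1)) g)` of `g`. -/
def schouten (g : Pt n → Mat n) (p : Pt n) : Mat n :=
  (1 / (n - 2 : ℝ)) •
    Matrix.of (fun i j => ricci g i j p - scalarCurv g p / (2 * (n - 1 : ℝ)) * g p i j)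

/-- `g` is flat (vanishing curvature, hence vanishing sectional curvature) on `s`. -/
def FlatOn (g : Pt n → Mat n) (s : Set (Pt n)) : Prop :=
  ∀ p ∈ s, ∀ l i j k, riemann g l i j k p = 0

/-- `g` is conformally flat on `s`: around each point of `s` some conformal multiple
`e^{2σ} g` has vanishing curvature. -/
def ConformallyFlatOn (g : Pt n → Mat n) (s : Set (Pt n)) : Prop :=
  ∀ p ∈ s, ∃ V : Set (Pt n), IsOpen V ∧ p ∈ V ∧ V ⊆ s ∧ ∃ σ : Pt n → ℝ,
    ContDiffOn ℝ (⊤ : ℕ∞) σ V ∧ FlatOn (fun q => Real.exp (2 * σ q) • g q) V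

/-- A coherent tangent bundle over a coordinate domain `U ⊆ ℝⁿ`, in the trivialization
`e₁,…,e_n` of the rank-`n` bundle `E`: `h` is the fiber metric `⟨e_a,e_b⟩`, `ω` are the
connection coefficients (`D_{∂ᵢ} e_b = Σ_a (ω i) a b • e_a`) and `φ` is the bundle
homomorphism (`φ(∂_j) = Σ_a φ a j • e_a`). -/
structure CTB (n : ℕ) where
  U : Set (Pt n)
  h : Pt n → Mat n
  ω : Fin n → Pt n → Mat n
  φ : Pt n → Mat n

namespace CTB

/-- `f` is a smooth bundle homomorphism `TM → E` satisfying the coherence condition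
`D_X f(Y) - D_Y f(X) - f([X,Y]) = 0`. -/
def IsCoherentHom (d : CTB n) (f : Pt n → Mat n) : Prop :=
  (∀ a j, ContDiffOn ℝ (⊤ : ℕ∞) (fun p => f p a j) d.U) ∧
  ∀ p ∈ d.U, ∀ a i j,
    pd i (fun q => f q a j) p + ∑ b, d.ω i p a b * f p b j
      = pd j (fun q => f q a i) p + ∑ b, d.ω j p a b * f p b i

/-- The axioms of a coherent tangent bundle: `U` open, `h` a smooth fiber metric,
`ω` a smooth metric connection, and `φ` a coherent smooth bundle homomorphism. -/
def IsCTB (d : CTB n) : Prop :=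
  IsOpen d.U ∧
  (∀ a b, ContDiffOn ℝ (⊤ : ℕ∞) (fun p => d.h p a b) d.U) ∧
  (∀ p ∈ d.U, (d.h p).IsSymm ∧ (d.h p).PosDef) ∧
  (∀ i a b, ContDiffOn ℝ (⊤ : ℕ∞) (fun p => d.ω i p a b) d.U) ∧
  (∀ p ∈ d.U, ∀ i a b,
    pd i (fun q => d.h q a b) p
      = (∑ c, d.ω i p c a * d.h p c b) + ∑ c, d.ω i p c b * d.h p a c) ∧
  d.IsCoherentHom d.φ

/-- The pull-back metric `g = φ*⟨,⟩`, i.e. `g_{ij} = ⟨φ(∂ᵢ), φ(∂ⱼ)⟩`. -/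
def gmet (d : CTB n) : Pt n → Mat n := fun p => (d.φ p)ᵀ * d.h p * d.φ p

/-- The regular set of `φ` (points of `U` where `φ` is injective). -/
def reg (d : CTB n) : Set (Pt n) := {p | p ∈ d.U ∧ (d.φ p).det ≠ 0}

/-- A generalized conformally flat manifold: a coherent tangent bundle with `n ≥ 3`,
dense regular set, and conformally flat pull-back metric on the regular set. -/
def IsGCF (d : CTB n) : Prop :=
  3 ≤ n ∧ d.IsCTB ∧ d.U ⊆ closure d.reg ∧ ConformallyFlatOn d.gmet d.reg

/-- The Schouten tensor of the pull-back metric. -/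
def schoutenT (d : CTB n) : Pt n → Mat n := fun p => schouten d.gmet p

/-- The set `R*` of non-parabolic regular points (where the Schouten tensor is
non-degenerate). -/
def regStar (d : CTB n) : Set (Pt n) := {p | p ∈ d.reg ∧ (d.schoutenT p).det ≠ 0}

/-- The dual metric `ǧ_{ij} = Σ_{a,b} A_{ia} A_{jb} g^{ab}` (in matrix form `A g⁻¹ A`,
using the symmetry of `A` and `g`). -/
def dualMet (d : CTB n) : Pt n → Mat n :=
  fun p => d.schoutenT p * (d.gmet p)⁻¹ * d.schoutenT p

/-- The tensor `Â = Σ g^{ia} A_{aj} ∂ᵢ ⊗ du^j`, i.e. `g⁻¹ A` in matrix form. -/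
def Ahat (d : CTB n) : Pt n → Mat n := fun p => (d.gmet p)⁻¹ * d.schoutenT p

/-- `ψ` is a smooth bundle homomorphism extending `φ ∘ Â` (defined on the regular set)
to all of `U`. -/
def IsDualHom (d : CTB n) (ψ : Pt n → Mat n) : Prop :=
  (∀ a j, ContDiffOn ℝ (⊤ : ℕ∞) (fun p => ψ p a j) d.U) ∧
  ∀ p ∈ d.reg, ψ p = d.φ p * d.Ahat p

/-- An admissible GCF-manifold: `R*` is dense and `φ ∘ Â` extends smoothly to `U`. -/
def IsAdmissible (d : CTB n) : Prop :=
  d.IsGCF ∧ d.U ⊆ closure d.regStar ∧ ∃ ψ, d.IsDualHom ψ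

end CTB

end Loc

/-- The Lorentz–Minkowski inner product of signature `(-,+,…,+)` on `ℝ^{n+2}`. -/
def mink (n : ℕ) (z w : Fin (n + 2) → ℝ) : ℝ :=
  ∑ i, (if i = 0 then (-1 : ℝ) else 1) * z i * w i

namespace Loc

open Matrix

/-- `i`-th partial derivative of a vector-valued map on `ℝⁿ`. -/
def pdv {n m : ℕ} (i : Fin n) (f : Pt n → (Fin m → ℝ)) (p : Pt n) : Fin m → ℝ :=
  fderiv ℝ f p (Pi.single i 1)

/-- A frontal bundle over a coordinate domain `U ⊆ ℝⁿ`: a rank-`n` bundle (trivialized,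
with fiber metric `h` and connection coefficients `ω`) together with two bundle
homomorphisms `ξ` and `ζ`. -/
structure FB (n : ℕ) where
  U : Set (Pt n)
  h : Pt n → Mat n
  ω : Fin n → Pt n → Mat n
  ξ : Pt n → Mat n
  ζ : Pt n → Mat n

namespace FB

variable {n : ℕ}

/-- The coherent tangent bundle with first homomorphism `ξ`. -/
def ctb1 (d : FB n) : CTB n := ⟨d.U, d.h, d.ω, d.ξ⟩

/-- The coherent tangent bundle with second homomorphism `ζ`. -/
def ctb2 (d : FB n) : CTB n := ⟨d.U, d.h, d.ω, d.ζ⟩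

/-- The frontal bundle axioms: both `(U,h,ω,ξ)` and `(U,h,ω,ζ)` are coherent tangent
bundles, and the compatibility `⟨ξ(X),ζ(Y)⟩ = ⟨ξ(Y),ζ(X)⟩` holds. -/
def IsFB (d : FB n) : Prop :=
  d.ctb1.IsCTB ∧ d.ctb2.IsCTB ∧ ∀ p ∈ d.U, ((d.ξ p)ᵀ * d.h p * d.ζ p).IsSymm

/-- First fundamental form `I(∂ᵢ,∂ⱼ) = ⟨ξ∂ᵢ, ξ∂ⱼ⟩`. -/
def FF1 (d : FB n) : Pt n → Mat n := fun p => (d.ξ p)ᵀ * d.h p * d.ξ p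

/-- Second fundamental form `II(∂ᵢ,∂ⱼ) = -⟨ξ∂ᵢ, ζ∂ⱼ⟩`. -/
def FF2 (d : FB n) : Pt n → Mat n := fun p => -((d.ξ p)ᵀ * d.h p * d.ζ p)

/-- Third fundamental form `III(∂ᵢ,∂ⱼ) = ⟨ζ∂ᵢ, ζ∂ⱼ⟩`. -/
def FF3 (d : FB n) : Pt n → Mat n := fun p => (d.ζ p)ᵀ * d.h p * d.ζ p

/-- Curvature `R^D` of the connection `D`:
`R^D(∂ᵢ,∂ⱼ) e_b = Σ_a (curv i j p) a b • e_a`. -/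
def curv (d : FB n) (i j : Fin n) (p : Pt n) : Mat n :=
  Matrix.of fun a b =>
    pd i (fun q => d.ω j q a b) p - pd j (fun q => d.ω i q a b) p
      + ∑ c, (d.ω i p a c * d.ω j p c b - d.ω j p a c * d.ω i p c b)

/-- The Gauss equation (for curvature `c = -1` split into the lightcone form):
`⟨R^D(X,Y)v,w⟩ = det(⟨ξY,v⟩,⟨ξY,w⟩;⟨ζX,v⟩,⟨ζX,w⟩) + det(⟨ζY,v⟩,⟨ζY,w⟩;⟨ξX,v⟩,⟨ξX,w⟩)`,
written out on the coordinate fields `X = ∂ᵢ, Y = ∂ⱼ` and frame sections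
`v = e_c, w = e_{c'}` (which suffices, both sides being tensorial). -/
def GaussEq (d : FB n) : Prop :=
  ∀ p ∈ d.U, ∀ i j c c' : Fin n,
    (∑ a, d.curv i j p a c * d.h p a c') =
      (((d.ξ p)ᵀ * d.h p) j c * ((d.ζ p)ᵀ * d.h p) i c'
        - ((d.ξ p)ᵀ * d.h p) j c' * ((d.ζ p)ᵀ * d.h p) i c)
      + (((d.ζ p)ᵀ * d.h p) j c * ((d.ξ p)ᵀ * d.h p) i c'
        - ((d.ζ p)ᵀ * d.h p) j c' * ((d.ξ p)ᵀ * d.h p) i c)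

end FB

/-- `x : U → Q^{n+1}_+` is a spacelike frontal with dual `y : U → Q^{n+1}_-`. -/
def IsSpacelikeFrontalOn (n : ℕ) (x y : Pt n → (Fin (n + 2) → ℝ)) (U : Set (Pt n)) :
    Prop :=
  ContDiffOn ℝ (⊤ : ℕ∞) x U ∧ ContDiffOn ℝ (⊤ : ℕ∞) y U ∧
  ∀ p ∈ U, mink n (x p) (x p) = 0 ∧ 0 < x p 0 ∧
    mink n (y p) (y p) = 0 ∧ y p 0 < 0 ∧ mink n (x p) (y p) = 1 ∧
    ∀ i, mink n (pdv i x p) (y p) = 0 ∧ mink n (pdv i y p) (x p) = 0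

end Loc


section frobenius
open Set Metric Topology NNReal
set_option maxSynthPendingDepth 3

theorem frob_ode {F : Type*} [NormedAddCommGroup F] [NormedSpace ℝ F] [CompleteSpace F]
    (A : ℝ → F →L[ℝ] F) (hA : ContinuousOn A (Icc 0 1)) (hb : ∀ t ∈ Icc (0:ℝ) 1, ‖A t‖ ≤ 1 / 2)
    (y0 : F) : ∃ y : ℝ → F, y 0 = y0 ∧
      ∀ t ∈ Icc (0:ℝ) 1, HasDerivWithinAt y (A t (y t)) (Icc 0 1) t := by
  have h01 : (0:ℝ) ∈ Icc (0:ℝ) 1 := by simp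
  have hpl : IsPicardLindelof (fun t x => A t x) (tmin := 0) (tmax := 1) ⟨0, h01⟩ y0
      ‖y0‖₊ 0 ‖y0‖₊ (1/2) := by
    refine ⟨?_, ?_, ?_, ?_⟩
    · intro t ht
      apply LipschitzWith.lipschitzOnWith
      refine (A t).lipschitz.weaken ?_
      rw [← NNReal.coe_le_coe]
      simpa using hb t ht
    · intro x hx
      exact hA.clm_apply continuousOn_const
    · intro t ht x hx
      have h1 : ‖x‖ ≤ 2 * ‖y0‖ := by
        have := mem_closedBall_iff_norm.1 hx
        have h2 := norm_add_le (x - y0) y0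
        simp at this h2
        linarith
      calc ‖A t x‖ ≤ ‖A t‖ * ‖x‖ := (A t).le_opNorm x
        _ ≤ 1 / 2 * (2 * ‖y0‖) := by
          gcongr
          exact hb t ht
        _ = _ := by simp
    · simp
  obtain ⟨y, hy0, hy⟩ := hpl.exists_eq_forall_mem_Icc_hasDerivWithinAt₀
  exact ⟨y, hy0, hy⟩

theorem frob_deriv {X F : Type*} [NormedAddCommGroup X] [NormedSpace ℝ X]
    [NormedAddCommGroup F] [NormedSpace ℝ F]
    (G : X → X →L[ℝ] F →L[ℝ] F) (p : X) (r C : ℝ) (hr1 : r ≤ 1)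
    (hC : 0 ≤ C)
    (hd : ∀ x ∈ ball p r, DifferentiableAt ℝ G x)
    (hG : ∀ x ∈ ball p r, ‖G x‖ ≤ C)
    (hG' : ∀ x ∈ ball p r, ‖fderiv ℝ G x‖ ≤ C)
    (hL : ∀ x ∈ ball p r, ∀ x' ∈ ball p r, ‖fderiv ℝ G x' - fderiv ℝ G x‖ ≤ C * ‖x' - x‖)
    (hflat : ∀ x ∈ ball p r, ∀ h k : X, ∀ y : F, fderiv ℝ G x h k y + G x k (G x h y)
      = fderiv ℝ G x k h y + G x h (G x k y))
    (Y : X → ℝ → F) (y0 : F) (hY0 : ∀ x ∈ ball p r, Y x 0 = y0)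
    (hY : ∀ x ∈ ball p r, ∀ t ∈ Icc (0:ℝ) 1,
      HasDerivWithinAt (Y x) (G (p + t • (x - p)) (x - p) (Y x t)) (Icc 0 1) t) :
    ∀ x ∈ ball p r, HasFDerivAt (fun x => Y x 1) ((G x).flip (Y x 1)) x := by
  intro x hx
  have hseg : ∀ x ∈ ball p r, ∀ t ∈ Icc (0:ℝ) 1, p + t • (x - p) ∈ ball p r := by
    intro x hx t ht
    have hp : p ∈ ball p r := mem_ball_self (lt_of_le_of_lt dist_nonneg (mem_ball.1 hx))
    exact (convex_ball p r).add_smul_sub_mem hp hx ht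
  have hyc : ∀ x ∈ ball p r, ContinuousOn (Y x) (Icc 0 1) := fun x hx t ht =>
    (hY x hx t ht).continuousWithinAt
  obtain ⟨B, hB⟩ := isCompact_Icc.exists_bound_of_continuousOn (hyc x hx)
  have hB0 : 0 ≤ B := (norm_nonneg _).trans (hB 0 (by simp))
  set C' : ℝ := C * B + C * C * B + C * (C * B) + 2 * C * (C * B) + C * (B + 2 * (C * B)) with hC'
  have hC'0 : 0 ≤ C' := by positivity
  -- main estimate
  have key : ∀ x' ∈ ball p r, ‖Y x' 1 - Y x 1 - G x (x' - x) (Y x 1)‖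
      ≤ gronwallBound 0 C 1 1 * C' * ‖x' - x‖ ^ 2 := by
    intro x' hx'
    set h := x' - x with hh
    set k := x - p with hk
    have hkh : x' - p = k + h := by rw [hh, hk]; abel
    have nk : ‖k‖ ≤ 1 := (mem_ball_iff_norm.1 hx).le.trans hr1
    have nkh : ‖k + h‖ ≤ 1 := by rw [← hkh]; exact (mem_ball_iff_norm.1 hx').le.trans hr1
    have nh : ‖h‖ ≤ 2 := by
      have := norm_sub_le (k + h) k
      simp at this; linarith
    have hz : ∀ t ∈ Icc (0:ℝ) 1, HasDerivWithinAt
        (fun t => Y x t + t • G (p + t • k) h (Y x t))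
        (G (p + t • k) k (Y x t) + (t • (fderiv ℝ G (p + t • k) k h (Y x t)
          + G (p + t • k) h (G (p + t • k) k (Y x t))) + G (p + t • k) h (Y x t)))
        (Icc 0 1) t := by
      intro t ht
      have h1 := hY x hx t ht
      have h2 : HasDerivWithinAt (fun t : ℝ => p + t • k) k (Icc 0 1) t := by
        simpa using (((hasDerivAt_id t).smul_const k).const_add p).hasDerivWithinAt
      have hdt := hd _ (hseg x hx t ht)
      rw [← hk] at hdt
      have h3 : HasDerivWithinAt (fun t : ℝ => G (p + t • k)) (fderiv ℝ G (p + t • k) k)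
          (Icc 0 1) t :=
        hdt.hasFDerivAt.comp_hasDerivWithinAt t h2
      rw [← hk] at h1
      have h4 := (h3.clm_apply (hasDerivWithinAt_const t _ h)).clm_apply h1
      have h5 := h1.add ((hasDerivWithinAt_id t _).smul h4)
      refine h5.congr_deriv ?_
      simp
    have bound : ∀ t ∈ Icc (0:ℝ) 1, ‖(G (p + t • k) k (Y x t) + (t • (fderiv ℝ G (p + t • k) k h (Y x t)
          + G (p + t • k) h (G (p + t • k) k (Y x t))) + G (p + t • k) h (Y x t)))
          - G (p + t • (k + h)) (k + h) (Y x t + t • G (p + t • k) h (Y x t))‖ ≤ C' * ‖h‖ ^ 2 := by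
      intro t ht
      have hc := hseg x hx t ht
      have hc' := hseg x' hx' t ht
      rw [hkh] at hc'
      rw [← hk] at hc
      have hfl := hflat _ hc k h (Y x t)
      have gB := hG _ hc
      have g'B := hG' _ hc
      have yB := hB t ht
      have hcc : p + t • (k + h) - (p + t • k) = t • h := by rw [smul_add]; abel
      have he : ‖G (p + t • (k + h)) - G (p + t • k) - fderiv ℝ G (p + t • k) (t • h)‖
          ≤ C * ‖h‖ ^ 2 := by
        have hsub : segment ℝ (p + t • k) (p + t • (k + h)) ⊆ ball p r :=
          (convex_ball p r).segment_subset hc hc'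
        have nth : ‖t • h‖ ≤ ‖h‖ := by
          rw [norm_smul, Real.norm_of_nonneg ht.1]
          exact mul_le_of_le_one_left (norm_nonneg _) ht.2
        have := (convex_segment (𝕜 := ℝ) (p + t • k) (p + t • (k + h))).norm_image_sub_le_of_norm_hasFDerivWithin_le'
          (f := G) (f' := fderiv ℝ G) (φ := fderiv ℝ G (p + t • k)) (C := C * ‖h‖)
          (fun z hz => (hd z (hsub hz)).hasFDerivAt.hasFDerivWithinAt) ?_
          (left_mem_segment _ _ _) (right_mem_segment _ _ _)
        · rw [hcc] at this
          refine this.trans ?_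
          rw [sq, ← mul_assoc]
          gcongr
        · intro z hz
          refine (hL _ hc _ (hsub hz)).trans ?_
          gcongr
          rw [segment_eq_image'] at hz
          obtain ⟨s, hs, rfl⟩ := hz
          rw [hcc, add_sub_cancel_left, norm_smul, Real.norm_of_nonneg hs.1]
          exact (mul_le_of_le_one_left (norm_nonneg _) hs.2).trans nth
      set e := G (p + t • (k + h)) - G (p + t • k) - fderiv ℝ G (p + t • k) (t • h) with hedef
      have hGe : G (p + t • (k + h)) = G (p + t • k) + t • fderiv ℝ G (p + t • k) h + e := by
        rw [hedef, map_smul]; abel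
      rw [hGe]
      set g := G (p + t • k)
      set g' := fderiv ℝ G (p + t • k)
      set y := Y x t
      have tn : ‖t‖ ≤ 1 := by rw [Real.norm_of_nonneg ht.1]; exact ht.2
      have expand : g k y + (t • (g' k h y + g h (g k y)) + g h y)
          - (g + t • g' h + e) (k + h) (y + t • g h y)
          = -(t • g' h h y + t • g h (g h y) + (t * t) • g' h k (g h y)
            + (t * t) • g' h h (g h y) + e (k + h) (y + t • g h y)) := by
        rw [hfl]
        simp only [add_apply, smul_apply, map_add, map_smul,
          smul_add, smul_smul]
        abel
      rw [expand, norm_neg]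
      have n1 : ‖g h y‖ ≤ C * ‖h‖ * B := (g h).le_of_opNorm_le_of_le (g.le_of_opNorm_le gB h) yB
      have n1' : ‖g h y‖ ≤ 2 * (C * B) := by
        refine n1.trans ?_
        have : C * ‖h‖ * B ≤ C * 2 * B := by gcongr
        linarith
      have n2 : ‖g' h h y‖ ≤ C * ‖h‖ * ‖h‖ * B :=
        (g' h h).le_of_opNorm_le_of_le ((g' h).le_of_opNorm_le (g'.le_of_opNorm_le g'B h) h) yB
      have n3 : ‖g h (g h y)‖ ≤ C * ‖h‖ * (C * ‖h‖ * B) :=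
        (g h).le_of_opNorm_le_of_le (g.le_of_opNorm_le gB h) n1
      have n4 : ‖g' h k (g h y)‖ ≤ C * ‖h‖ * 1 * (C * ‖h‖ * B) :=
        (g' h k).le_of_opNorm_le_of_le
          ((g' h).le_of_opNorm_le_of_le (g'.le_of_opNorm_le g'B h) nk) n1
      have n5 : ‖g' h h (g h y)‖ ≤ C * ‖h‖ * 2 * (C * ‖h‖ * B) :=
        (g' h h).le_of_opNorm_le_of_le
          ((g' h).le_of_opNorm_le_of_le (g'.le_of_opNorm_le g'B h) nh) n1
      have hts : ∀ w : F, ‖t • w‖ ≤ ‖w‖ := fun w => by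
        rw [norm_smul]; exact mul_le_of_le_one_left (norm_nonneg _) tn
      have n6 : ‖e (k + h) (y + t • g h y)‖ ≤ C * ‖h‖ ^ 2 * 1 * (B + 2 * (C * B)) :=
        (e (k + h)).le_of_opNorm_le_of_le (e.le_of_opNorm_le_of_le he nkh)
          ((norm_add_le _ _).trans (add_le_add yB ((hts _).trans n1')))
      have htts : ∀ w : F, ‖(t * t) • w‖ ≤ ‖w‖ := fun w => by
        rw [mul_smul]; exact (hts _).trans (hts _)
      calc _ ≤ ‖t • g' h h y‖ + ‖t • g h (g h y)‖ + ‖(t * t) • g' h k (g h y)‖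
            + ‖(t * t) • g' h h (g h y)‖ + ‖e (k + h) (y + t • g h y)‖ := by
            refine (norm_add_le _ _).trans (add_le_add_left ?_ _)
            exact norm_add₄_le
        _ ≤ C * ‖h‖ * ‖h‖ * B + C * ‖h‖ * (C * ‖h‖ * B) + C * ‖h‖ * 1 * (C * ‖h‖ * B)
            + C * ‖h‖ * 2 * (C * ‖h‖ * B) + C * ‖h‖ ^ 2 * 1 * (B + 2 * (C * B)) :=
            add_le_add (add_le_add (add_le_add (add_le_add ((hts _).trans n2) ((hts _).trans n3))
              ((htts _).trans n4)) ((htts _).trans n5)) n6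
        _ = C' * ‖h‖ ^ 2 := by rw [hC']; ring
    have gron := dist_le_of_approx_trajectories_ODE_of_mem
      (v := fun t => G (p + t • (k + h)) (k + h)) (K := C.toNNReal) (s := fun _ => univ) (a := 0) (b := 1)
      (f := Y x') (f' := fun t => G (p + t • (k + h)) (k + h) (Y x' t))
      (g := fun t => Y x t + t • G (p + t • k) h (Y x t))
      (g' := fun t => G (p + t • k) k (Y x t) + (t • (fderiv ℝ G (p + t • k) k h (Y x t)
          + G (p + t • k) h (G (p + t • k) k (Y x t))) + G (p + t • k) h (Y x t)))
      (εf := 0) (εg := C' * ‖h‖ ^ 2) (δ := 0)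
      ?_ (hyc x' hx') ?_ ?_ (fun _ _ => trivial) ?_ ?_ ?_ (fun _ _ => trivial) ?_ 1 (by simp)
    · simp only [one_smul, zero_add, sub_zero, Real.coe_toNNReal C hC] at gron
      have : p + k = x := by rw [hk]; abel
      rw [this, dist_eq_norm] at gron
      rw [sub_sub]
      refine gron.trans (le_of_eq ?_)
      simp only [gronwallBound]
      split_ifs
      · simp
      · simp; ring
    · intro t ht
      apply LipschitzWith.lipschitzOnWith
      refine (G (p + t • (k + h)) (k + h)).lipschitz.weaken ?_
      rw [← NNReal.coe_le_coe, Real.coe_toNNReal C hC]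
      have := hseg x' hx' t ⟨ht.1, ht.2.le⟩
      rw [hkh] at this
      have := (G (p + t • (k + h))).le_of_opNorm_le_of_le (hG _ this) nkh
      rw [mul_one] at this
      exact this
    · intro t ht
      have := hY x' hx' t ⟨ht.1, ht.2.le⟩
      rw [hkh] at this
      exact this.mono_of_mem_nhdsWithin (Icc_mem_nhdsGE_of_mem ht)
    · intro t ht; simp
    · exact fun t ht => (hz t ht).continuousWithinAt
    · intro t ht
      exact (hz t ⟨ht.1, ht.2.le⟩).mono_of_mem_nhdsWithin (Icc_mem_nhdsGE_of_mem ht)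
    · intro t ht
      rw [dist_eq_norm]
      exact bound t ⟨ht.1, ht.2.le⟩
    · simp [hY0 x hx, hY0 x' hx']
  rw [hasFDerivAt_iff_isLittleO]
  have hO : (fun x' => Y x' 1 - Y x 1 - (G x).flip (Y x 1) (x' - x)) =O[𝓝 x]
      (fun x' => ‖x' - x‖ ^ 2) := by
    refine Asymptotics.IsBigO.of_bound (gronwallBound 0 C 1 1 * C') ?_
    filter_upwards [isOpen_ball.mem_nhds hx] with x' hx'
    simpa using key x' hx'
  refine hO.trans_isLittleO ?_
  have := (Asymptotics.isLittleO_norm_pow_id (E' := X) (n := 2) (by norm_num)).comp_tendsto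
    (tendsto_sub_nhds_zero_iff.2 (Filter.tendsto_id (x := 𝓝 x)))
  exact this

theorem frob {X F : Type*} [NormedAddCommGroup X] [NormedSpace ℝ X]
    [NormedAddCommGroup F] [NormedSpace ℝ F] [CompleteSpace F]
    (G : X → X →L[ℝ] F →L[ℝ] F) (p : X) (hG : ContDiffAt ℝ 3 G p)
    (hflat : ∀ᶠ x in 𝓝 p, ∀ h k : X, ∀ y : F, fderiv ℝ G x h k y + G x k (G x h y)
      = fderiv ℝ G x k h y + G x h (G x k y)) (y0 : F) :
    ∃ r > 0, ∃ Y : X → F, Y p = y0 ∧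
      ∀ x ∈ ball p r, HasFDerivAt Y ((G x).flip (Y x)) x := by
  have h1 : ContDiffAt ℝ 2 (fderiv ℝ G) p := hG.fderiv_right (by norm_num)
  obtain ⟨K, t, ht, hK⟩ := (h1.of_le (show (1 : WithTop ℕ∞) ≤ 2 by norm_num)).exists_lipschitzOnWith
  have hdiff : ∀ᶠ x in 𝓝 p, DifferentiableAt ℝ G x := by
    filter_upwards [hG.eventually (by simp)] with x hx
    exact hx.differentiableAt (by norm_num)
  have b1 : ∀ᶠ x in 𝓝 p, ‖G x‖ ≤ ‖G p‖ + 1 := by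
    filter_upwards [hG.continuousAt.norm.eventually_lt_const (lt_add_one _)] with x hx using hx.le
  have b2 : ∀ᶠ x in 𝓝 p, ‖fderiv ℝ G x‖ ≤ ‖fderiv ℝ G p‖ + 1 := by
    filter_upwards [h1.continuousAt.norm.eventually_lt_const (lt_add_one _)] with x hx using hx.le
  obtain ⟨r0, hr0, hall⟩ := Metric.eventually_nhds_iff_ball.1
    ((((hflat.and hdiff).and b1).and b2).and (ht : ∀ᶠ x in 𝓝 p, x ∈ t))
  set C : ℝ := ‖G p‖ + 1 + ‖fderiv ℝ G p‖ + K with hC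
  have hK0 : (0:ℝ) ≤ K := K.2
  have hC0 : 0 < C := by positivity
  set r := min r0 (min 1 (1 / (2 * C))) with hr
  have hrpos : 0 < r := by positivity
  have hsub : ball p r ⊆ ball p r0 := ball_subset_ball (min_le_left _ _)
  have hr1 : r ≤ 1 := (min_le_right _ _).trans (min_le_left _ _)
  have hrC : C * r ≤ 1 / 2 := by
    have : r ≤ 1 / (2 * C) := (min_le_right _ _).trans (min_le_right _ _)
    calc C * r ≤ C * (1 / (2 * C)) := by gcongr
      _ = 1 / 2 := by field_simp
  have hGC : ∀ x ∈ ball p r, ‖G x‖ ≤ C := fun x hx => by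
    have := (hall x (hsub hx)).1.1.2
    have := norm_nonneg (fderiv ℝ G p)
    linarith
  have hdG : ∀ x ∈ ball p r, DifferentiableAt ℝ G x := fun x hx => (hall x (hsub hx)).1.1.1.2
  have hseg : ∀ x ∈ ball p r, ∀ t ∈ Icc (0:ℝ) 1, p + t • (x - p) ∈ ball p r := by
    intro x hx t ht
    exact (convex_ball p r).add_smul_sub_mem (mem_ball_self hrpos) hx ht
  have hex : ∀ x, ∃ y : ℝ → F, y 0 = y0 ∧ (x ∈ ball p r →
      ∀ t ∈ Icc (0:ℝ) 1, HasDerivWithinAt y (G (p + t • (x - p)) (x - p) (y t)) (Icc 0 1) t) := by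
    intro x
    by_cases hx : x ∈ ball p r
    · obtain ⟨y, hy0, hy⟩ := frob_ode (fun t => G (p + t • (x - p)) (x - p)) (by
        refine ContinuousOn.clm_apply ?_ continuousOn_const
        intro t ht
        have h2 : ContinuousAt (fun t : ℝ => p + t • (x - p)) t := by fun_prop
        exact (ContinuousAt.comp (f := fun t : ℝ => p + t • (x - p)) (x := t)
          (hdG _ (hseg x hx t ht)).continuousAt h2).continuousWithinAt) (by
        intro t ht
        refine ((G _).le_of_opNorm_le_of_le (hGC _ (hseg x hx t ht))
          (mem_ball_iff_norm.1 hx).le).trans hrC) y0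
      exact ⟨y, hy0, fun _ => hy⟩
    · exact ⟨fun _ => y0, rfl, fun h => absurd h hx⟩
  choose Y hY0 hY using hex
  refine ⟨r, hrpos, fun x => Y x 1, ?_, ?_⟩
  · have h2 := hY p (mem_ball_self hrpos)
    have := constant_of_has_deriv_right_zero (f := Y p) (a := 0) (b := 1)
      (fun t ht => (h2 t ht).continuousWithinAt) (fun t ht => by
        have := (h2 t ⟨ht.1, ht.2.le⟩).mono_of_mem_nhdsWithin (Icc_mem_nhdsGE_of_mem ht)
        simpa using this) 1 (by simp)
    exact this.trans (hY0 p)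
  · refine frob_deriv G p r C hr1 hC0.le hdG hGC ?_ ?_ ?_ Y y0 (fun x _ => hY0 x) hY
    · intro x hx
      have := (hall x (hsub hx)).1.2
      have := norm_nonneg (G p)
      linarith
    · intro x hx x' hx'
      have := hK.norm_sub_le (hall x' (hsub hx')).2 (hall x (hsub hx)).2
      refine this.trans ?_
      gcongr
      have := norm_nonneg (G p)
      have := norm_nonneg (fderiv ℝ G p)
      linarith
    · intro x hx
      exact (hall x (hsub hx)).1.1.1.1

theorem frob_smooth {X F : Type*} [NormedAddCommGroup X] [NormedSpace ℝ X]
    [NormedAddCommGroup F] [NormedSpace ℝ F]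
    (G : X → X →L[ℝ] F →L[ℝ] F) (V : Set X) (hV : IsOpen V) (hG : ContDiffOn ℝ (⊤ : ℕ∞) G V)
    (Y : X → F) (hY : ∀ x ∈ V, HasFDerivAt Y ((G x).flip (Y x)) x) :
    ContDiffOn ℝ (⊤ : ℕ∞) Y V := by
  have : ∀ m : ℕ, ContDiffOn ℝ m Y V := by
    intro m
    induction m with
    | zero =>
      exact contDiffOn_zero.2 fun x hx => (hY x hx).continuousAt.continuousWithinAt
    | succ m ih =>
      push_cast
      rw [contDiffOn_succ_iff_fderiv_of_isOpen hV]
      refine ⟨fun x hx => (hY x hx).differentiableAt.differentiableWithinAt, by simp, ?_⟩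
      have h1 : ContDiffOn ℝ m (fun x => (G x).flip (Y x)) V := by
        refine ContDiffOn.clm_apply ?_ ih
        exact (ContinuousLinearMap.flipₗᵢ ℝ X F F).contDiff.comp_contDiffOn
          (hG.of_le (by exact_mod_cast le_top))
      exact h1.congr fun x hx => (hY x hx).fderiv
  exact contDiffOn_infty.2 this

end frobenius


noncomputable section
namespace Loc
open Matrix Set Metric Topology
set_option maxSynthPendingDepth 3

section calculus
variable {n : ℕ} {ι κ μ : Type*}

/-- Entrywise partial derivative of a matrix-valued function. -/
def pdM (i : Fin n) (F : Pt n → Matrix ι κ ℝ) (p : Pt n) : Matrix ι κ ℝ :=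
  Matrix.of fun a b => pd i (fun q => F q a b) p

/-- Entrywise smoothness. -/
def SmM (F : Pt n → Matrix ι κ ℝ) (V : Set (Pt n)) : Prop :=
  ∀ a b, ContDiffOn ℝ (⊤ : ℕ∞) (fun q => F q a b) V

/-- Entrywise differentiability. -/
def DM (F : Pt n → Matrix ι κ ℝ) (p : Pt n) : Prop :=
  ∀ a b, DifferentiableAt ℝ (fun q => F q a b) p

theorem sm_diffAt {f : Pt n → ℝ} {V : Set (Pt n)} (hV : IsOpen V)
    (hf : ContDiffOn ℝ (⊤ : ℕ∞) f V) {p : Pt n} (hp : p ∈ V) : DifferentiableAt ℝ f p :=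
  (hf.contDiffAt (hV.mem_nhds hp)).differentiableAt (by simp)

theorem SmM.dm {F : Pt n → Matrix ι κ ℝ} {V : Set (Pt n)} (hV : IsOpen V) (hF : SmM F V)
    {p : Pt n} (hp : p ∈ V) : DM F p := fun a b => sm_diffAt hV (hF a b) hp

theorem SmM.mono {F : Pt n → Matrix ι κ ℝ} {V W : Set (Pt n)} (hF : SmM F V) (h : W ⊆ V) :
    SmM F W := fun a b => (hF a b).mono h

theorem SmM.congr {F G : Pt n → Matrix ι κ ℝ} {V : Set (Pt n)} (hF : SmM F V)
    (h : ∀ q ∈ V, G q = F q) : SmM G V := fun a b =>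
  (hF a b).congr fun q hq => by rw [h q hq]

theorem pd_mul {f g : Pt n → ℝ} {p : Pt n} (i : Fin n) (hf : DifferentiableAt ℝ f p)
    (hg : DifferentiableAt ℝ g p) :
    pd i (fun q => f q * g q) p = pd i f p * g p + f p * pd i g p := by
  unfold pd
  rw [fderiv_fun_mul hf hg]
  simp
  ring

theorem pd_sum {α : Type*} {s : Finset α} {f : α → Pt n → ℝ} {p : Pt n} (i : Fin n)
    (hf : ∀ a ∈ s, DifferentiableAt ℝ (f a) p) :
    pd i (fun q => ∑ a ∈ s, f a q) p = ∑ a ∈ s, pd i (f a) p := by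
  unfold pd
  rw [fderiv_fun_sum hf]
  simp

theorem pdM_mul [Fintype κ] {F : Pt n → Matrix ι κ ℝ} {G : Pt n → Matrix κ μ ℝ} {p : Pt n}
    (i : Fin n) (hF : DM F p) (hG : DM G p) :
    pdM i (fun q => F q * G q) p = pdM i F p * G p + F p * pdM i G p := by
  ext a b
  simp only [pdM, Matrix.of_apply, Matrix.add_apply, Matrix.mul_apply]
  rw [pd_sum i (fun c _ => (hF a c).fun_mul (hG c b)), ← Finset.sum_add_distrib]
  exact Finset.sum_congr rfl fun c _ => pd_mul i (hF a c) (hG c b)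

theorem DM.mul [Fintype κ] {F : Pt n → Matrix ι κ ℝ} {G : Pt n → Matrix κ μ ℝ} {p : Pt n}
    (hF : DM F p) (hG : DM G p) : DM (fun q => F q * G q) p := by
  intro a b
  simp only [Matrix.mul_apply]
  exact DifferentiableAt.fun_sum fun c _ => (hF a c).mul (hG c b)

theorem SmM.mul [Fintype κ] {F : Pt n → Matrix ι κ ℝ} {G : Pt n → Matrix κ μ ℝ} {V : Set (Pt n)}
    (hF : SmM F V) (hG : SmM G V) : SmM (fun q => F q * G q) V := by
  intro a b
  simp only [Matrix.mul_apply]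
  exact ContDiffOn.sum fun c _ => (hF a c).mul (hG c b)

theorem pdM_add {F G : Pt n → Matrix ι κ ℝ} {p : Pt n}
    (i : Fin n) (hF : DM F p) (hG : DM G p) :
    pdM i (fun q => F q + G q) p = pdM i F p + pdM i G p := by
  ext a b
  simp only [pdM, Matrix.of_apply, Matrix.add_apply, pd]
  rw [fderiv_fun_add (hF a b) (hG a b)]
  rfl

theorem pdM_sub {F G : Pt n → Matrix ι κ ℝ} {p : Pt n}
    (i : Fin n) (hF : DM F p) (hG : DM G p) :
    pdM i (fun q => F q - G q) p = pdM i F p - pdM i G p := by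
  ext a b
  simp only [pdM, Matrix.of_apply, Matrix.sub_apply, pd]
  rw [fderiv_fun_sub (hF a b) (hG a b)]
  rfl

theorem pdM_neg {F : Pt n → Matrix ι κ ℝ} {p : Pt n} (i : Fin n) :
    pdM i (fun q => - F q) p = - pdM i F p := by
  ext a b
  simp only [pdM, Matrix.of_apply, Matrix.neg_apply, pd]
  rw [fderiv_fun_neg]
  rfl

theorem pdM_smul {f : Pt n → ℝ} {F : Pt n → Matrix ι κ ℝ} {p : Pt n}
    (i : Fin n) (hf : DifferentiableAt ℝ f p) (hF : DM F p) :
    pdM i (fun q => f q • F q) p = pd i f p • F p + f p • pdM i F p := by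
  ext a b
  simp only [pdM, Matrix.of_apply, Matrix.add_apply, Matrix.smul_apply, smul_eq_mul]
  exact pd_mul i hf (hF a b)

theorem pdM_transpose {F : Pt n → Matrix ι κ ℝ} {p : Pt n} (i : Fin n) :
    pdM i (fun q => (F q)ᵀ) p = (pdM i F p)ᵀ := rfl

theorem DM.add {F G : Pt n → Matrix ι κ ℝ} {p : Pt n}
    (hF : DM F p) (hG : DM G p) : DM (fun q => F q + G q) p :=
  fun a b => (hF a b).add (hG a b)

theorem DM.sub {F G : Pt n → Matrix ι κ ℝ} {p : Pt n}
    (hF : DM F p) (hG : DM G p) : DM (fun q => F q - G q) p :=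
  fun a b => (hF a b).sub (hG a b)

theorem DM.transpose {F : Pt n → Matrix ι κ ℝ} {p : Pt n}
    (hF : DM F p) : DM (fun q => (F q)ᵀ) p := fun a b => hF b a

theorem SmM.add {F G : Pt n → Matrix ι κ ℝ} {V : Set (Pt n)}
    (hF : SmM F V) (hG : SmM G V) : SmM (fun q => F q + G q) V :=
  fun a b => (hF a b).add (hG a b)

theorem SmM.sub {F G : Pt n → Matrix ι κ ℝ} {V : Set (Pt n)}
    (hF : SmM F V) (hG : SmM G V) : SmM (fun q => F q - G q) V :=
  fun a b => (hF a b).sub (hG a b)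

theorem SmM.neg {F : Pt n → Matrix ι κ ℝ} {V : Set (Pt n)}
    (hF : SmM F V) : SmM (fun q => - F q) V :=
  fun a b => (hF a b).neg

theorem SmM.transpose {F : Pt n → Matrix ι κ ℝ} {V : Set (Pt n)}
    (hF : SmM F V) : SmM (fun q => (F q)ᵀ) V := fun a b => hF b a

theorem SmM.smul {f : Pt n → ℝ} {F : Pt n → Matrix ι κ ℝ} {V : Set (Pt n)}
    (hf : ContDiffOn ℝ (⊤ : ℕ∞) f V) (hF : SmM F V) : SmM (fun q => f q • F q) V :=
  fun a b => hf.mul (hF a b)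

theorem sm_pd {f : Pt n → ℝ} {V : Set (Pt n)} (hV : IsOpen V)
    (hf : ContDiffOn ℝ (⊤ : ℕ∞) f V) (i : Fin n) : ContDiffOn ℝ (⊤ : ℕ∞) (pd i f) V := by
  have : ContDiffOn ℝ (⊤ : ℕ∞) (fderiv ℝ f) V := hf.fderiv_of_isOpen hV (by simp)
  exact this.clm_apply contDiffOn_const

theorem SmM.pdM {F : Pt n → Matrix ι κ ℝ} {V : Set (Pt n)} (hV : IsOpen V)
    (hF : SmM F V) (i : Fin n) : SmM (pdM i F) V := fun a b => sm_pd hV (hF a b) i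

theorem pd_congr {f g : Pt n → ℝ} {V : Set (Pt n)} (hV : IsOpen V) {p : Pt n} (hp : p ∈ V)
    (h : ∀ q ∈ V, f q = g q) (i : Fin n) : pd i f p = pd i g p := by
  unfold pd
  rw [Filter.EventuallyEq.fderiv_eq]
  filter_upwards [hV.mem_nhds hp] with q hq using h q hq

theorem pdM_congr {F G : Pt n → Matrix ι κ ℝ} {V : Set (Pt n)} (hV : IsOpen V) {p : Pt n}
    (hp : p ∈ V) (h : ∀ q ∈ V, F q = G q) (i : Fin n) : pdM i F p = pdM i G p := by
  ext a b
  exact pd_congr hV hp (fun q hq => by rw [h q hq]) i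

theorem pd_comm {f : Pt n → ℝ} {V : Set (Pt n)} (hV : IsOpen V)
    (hf : ContDiffOn ℝ (⊤ : ℕ∞) f V) {p : Pt n} (hp : p ∈ V) (i j : Fin n) :
    pd i (pd j f) p = pd j (pd i f) p := by
  have hc := hf.contDiffAt (hV.mem_nhds hp)
  have hsym : IsSymmSndFDerivAt ℝ f p := hc.isSymmSndFDerivAt (by
    simpa using (WithTop.coe_le_coe.2 (le_top : (2:ℕ∞) ≤ ⊤)))
  have hd : DifferentiableAt ℝ (fderiv ℝ f) p :=
    (hc.fderiv_right (m := (⊤ : ℕ∞)) (by simp)).differentiableAt (by simp)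
  have key : ∀ i j : Fin n, pd i (pd j f) p
      = fderiv ℝ (fderiv ℝ f) p (Pi.single i 1) (Pi.single j 1) := by
    intro i j
    show fderiv ℝ (fun q => fderiv ℝ f q (Pi.single j 1)) p (Pi.single i 1) = _
    rw [fderiv_clm_apply hd (differentiableAt_const _)]
    simp
  rw [key, key]
  exact hsym _ _

theorem pdM_comm {F : Pt n → Matrix ι κ ℝ} {V : Set (Pt n)} (hV : IsOpen V)
    (hF : SmM F V) {p : Pt n} (hp : p ∈ V) (i j : Fin n) :
    Loc.pdM i (Loc.pdM j F) p = Loc.pdM j (Loc.pdM i F) p := by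
  ext a b
  exact pd_comm hV (hF a b) hp i j

theorem sm_det [Fintype ι] [DecidableEq ι] {F : Pt n → Matrix ι ι ℝ} {V : Set (Pt n)}
    (hF : SmM F V) : ContDiffOn ℝ (⊤ : ℕ∞) (fun q => (F q).det) V := by
  simp only [Matrix.det_apply']
  exact ContDiffOn.sum fun s _ => contDiffOn_const.mul (contDiffOn_prod fun i _ => hF _ _)

theorem SmM.inv [Fintype ι] [DecidableEq ι] {F : Pt n → Matrix ι ι ℝ} {V : Set (Pt n)}
    (hF : SmM F V) (h : ∀ q ∈ V, (F q).det ≠ 0) : SmM (fun q => (F q)⁻¹) V := by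
  intro a b
  have : ∀ q, (F q)⁻¹ a b = (F q).det⁻¹ * ((F q).updateRow b (Pi.single a 1)).det := by
    intro q
    rw [Matrix.inv_def, Ring.inverse_eq_inv', Matrix.smul_apply, Matrix.adjugate_apply, smul_eq_mul]
  simp only [this]
  refine ((sm_det hF).inv h).mul (sm_det ?_)
  intro c e
  simp only [Matrix.updateRow_apply]
  split_ifs
  · exact contDiffOn_const
  · exact hF c e

theorem fderiv_eq_sum {f : Pt n → ℝ} {p : Pt n} (v : Pt n) :
    fderiv ℝ f p v = ∑ i, v i * pd i f p := by
  conv_lhs => rw [← Finset.univ_sum_single v]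
  rw [map_sum]
  refine Finset.sum_congr rfl fun i _ => ?_
  have : (Pi.single i (v i) : Pt n) = v i • Pi.single i 1 := by
    rw [← Pi.single_smul]; simp
  rw [this, map_smul]
  rfl

end calculus

section parallel
variable {n : ℕ} {ι : Type*} [Fintype ι] [DecidableEq ι]

/-- Local existence of parallel sections of a flat linear connection. -/
theorem exists_parallel (M : Fin n → Pt n → Matrix ι ι ℝ) {V : Set (Pt n)} (hV : IsOpen V)
    (hM : ∀ i, SmM (M i) V)
    (hflat : ∀ p ∈ V, ∀ i j, pdM i (M j) p + M j p * M i p = pdM j (M i) p + M i p * M j p)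
    (p : Pt n) (hp : p ∈ V) (y0 : ι → ℝ) :
    ∃ r > 0, ball p r ⊆ V ∧ ∃ Y : Pt n → Matrix ι Unit ℝ, (∀ a, Y p a () = y0 a) ∧
      SmM Y (ball p r) ∧ ∀ x ∈ ball p r, ∀ i, pdM i Y x = M i x * Y x := by
  let K : Fin n → ι → ι → (Pt n →L[ℝ] (ι → ℝ) →L[ℝ] (ι → ℝ)) := fun i a b =>
    (ContinuousLinearMap.proj i : Pt n →L[ℝ] ℝ).smulRight
      ((ContinuousLinearMap.proj b : (ι → ℝ) →L[ℝ] ℝ).smulRight (Pi.single a (1:ℝ)))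
  let G : Pt n → (Pt n →L[ℝ] (ι → ℝ) →L[ℝ] (ι → ℝ)) := fun x =>
    ∑ i, ∑ a, ∑ b, M i x a b • K i a b
  have hsumK : ∀ (N : Fin n → Matrix ι ι ℝ) (h : Pt n) (y : ι → ℝ),
      (∑ i, ∑ a, ∑ b, N i a b • K i a b) h y = ∑ i, h i • (N i).mulVec y := by
    intro N h y
    ext c
    simp only [_root_.sum_apply, Finset.sum_apply, Pi.smul_apply, _root_.smul_apply, K,
      ContinuousLinearMap.smulRight_apply, ContinuousLinearMap.proj_apply, smul_eq_mul,
      Matrix.mulVec, dotProduct, Finset.mul_sum]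
    refine Finset.sum_congr rfl fun i _ => ?_
    rw [Finset.sum_eq_single c]
    · refine Finset.sum_congr rfl fun b _ => ?_
      simp
      ring
    · intro a _ hac
      refine Finset.sum_eq_zero fun b _ => ?_
      simp [Pi.single_apply, hac.symm]
    · simp
  have hGapp : ∀ x h y, G x h y = ∑ i, h i • (M i x).mulVec y := fun x h y =>
    hsumK (fun i => M i x) h y
  have hGs : ContDiffOn ℝ (⊤ : ℕ∞) G V :=
    ContDiffOn.sum fun i _ => ContDiffOn.sum fun a _ => ContDiffOn.sum fun b _ =>
      (hM i a b).smul contDiffOn_const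
  have hGd : ∀ x ∈ V, ∀ h k y, fderiv ℝ G x h k y
      = ∑ i, k i • (∑ j, h j • pdM j (M i) x).mulVec y := by
    intro x hx h k y
    have : fderiv ℝ G x h = ∑ i, ∑ a, ∑ b, (∑ j, h j • pdM j (M i) x) a b • K i a b := by
      have h1 : HasFDerivAt G (∑ i, ∑ a, ∑ b,
          (fderiv ℝ (fun q => M i q a b) x).smulRight (K i a b)) x := by
        refine HasFDerivAt.fun_sum fun i _ => HasFDerivAt.fun_sum fun a _ =>
          HasFDerivAt.fun_sum fun b _ => ?_
        exact ((hM i).dm hV hx a b).hasFDerivAt.smul_const (K i a b)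
      rw [h1.fderiv]
      simp only [_root_.sum_apply, ContinuousLinearMap.smulRight_apply]
      refine Finset.sum_congr rfl fun i _ => Finset.sum_congr rfl fun a _ =>
        Finset.sum_congr rfl fun b _ => ?_
      rw [fderiv_eq_sum, Matrix.sum_apply]
      rfl
    rw [this, hsumK]
  have hLHS : ∀ x ∈ V, ∀ h k y, fderiv ℝ G x h k y + G x k (G x h y)
      = ∑ i, ∑ j, (k i * h j) • (pdM j (M i) x + M i x * M j x).mulVec y := by
    intro x hx h k y
    rw [hGd x hx, hGapp, hGapp, ← Finset.sum_add_distrib]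
    refine Finset.sum_congr rfl fun i _ => ?_
    rw [← smul_add, Matrix.sum_mulVec, Matrix.mulVec_sum, ← Finset.sum_add_distrib, Finset.smul_sum]
    refine Finset.sum_congr rfl fun j _ => ?_
    rw [Matrix.smul_mulVec, Matrix.mulVec_smul, Matrix.mulVec_mulVec, Matrix.add_mulVec, mul_smul,
      smul_add (h j)]
  obtain ⟨r0, hr0, hsub⟩ := Metric.isOpen_iff.1 hV p hp
  obtain ⟨r, hr, Y, hYp, hY⟩ := frob G p ((hGs.contDiffAt (hV.mem_nhds hp)).of_le 
      (WithTop.coe_le_coe.2 (le_top : (3:ℕ∞) ≤ ⊤))) (by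
    filter_upwards [hV.mem_nhds hp] with x hx h k y
    rw [hLHS x hx, hLHS x hx, Finset.sum_comm]
    refine Finset.sum_congr rfl fun i _ => Finset.sum_congr rfl fun j _ => ?_
    rw [hflat x hx i j, mul_comm]) y0
  have hb1 : ball p (min r0 r) ⊆ V := (ball_subset_ball (min_le_left _ _)).trans hsub
  have hb2 : ∀ x ∈ ball p (min r0 r), HasFDerivAt Y ((G x).flip (Y x)) x := fun x hx =>
    hY x (ball_subset_ball (min_le_right _ _) hx)
  refine ⟨min r0 r, lt_min hr0 hr, hb1, fun x => Matrix.of fun a _ => Y x a, ?_, ?_, ?_⟩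
  · intro a; simp [hYp]
  · intro a b
    exact contDiffOn_pi.1 (frob_smooth G _ isOpen_ball (hGs.mono hb1) Y hb2) a
  · intro x hx i
    ext a b
    have h1 := (hasFDerivAt_pi'.1 (hb2 x hx) a)
    simp only [pdM, pd, Matrix.of_apply]
    rw [h1.fderiv]
    simp only [ContinuousLinearMap.comp_apply, ContinuousLinearMap.proj_apply,
      ContinuousLinearMap.flip_apply]
    rw [hGapp, Finset.sum_eq_single i]
    · simp [Matrix.mulVec, dotProduct, Matrix.mul_apply]
    · intro j _ hj
      simp [Pi.single_apply, hj]
    · simp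
end parallel
end Loc
end


noncomputable section
namespace Loc
open Matrix Set Metric Topology
set_option maxSynthPendingDepth 3

section geometry
variable {n : ℕ}

/-- Curvature of connection matrices. -/
def curvM (ω : Fin n → Pt n → Mat n) (i j : Fin n) (p : Pt n) : Mat n :=
  pdM i (ω j) p - pdM j (ω i) p + (ω i p * ω j p - ω j p * ω i p)

theorem christoffel_eq {V : Set (Pt n)} (hV : IsOpen V) (h φ : Pt n → Mat n)
    (ω : Fin n → Pt n → Mat n) (hh : SmM h V) (hφ : SmM φ V)
    (hsym : ∀ p ∈ V, (h p)ᵀ = h p) (hdet : ∀ p ∈ V, (h p).det ≠ 0)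
    (hdetφ : ∀ p ∈ V, (φ p).det ≠ 0)
    (hmet : ∀ p ∈ V, ∀ i, pdM i h p = (ω i p)ᵀ * h p + h p * ω i p)
    (hcoh : ∀ p ∈ V, ∀ a i j, (pdM i φ p + ω i p * φ p) a j = (pdM j φ p + ω j p * φ p) a i) :
    ∀ p ∈ V, ∀ l i j, christoffel (fun q => (φ q)ᵀ * h q * φ q) l i j p
      = ((φ p)⁻¹ * (pdM i φ p + ω i p * φ p)) l j := by
  intro p hp l i j
  set g : Pt n → Mat n := fun q => (φ q)ᵀ * h q * φ q with hg
  have uφ : IsUnit (φ p).det := (hdetφ p hp).isUnit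
  have ug : IsUnit (g p).det := by
    simp only [hg, Matrix.det_mul, Matrix.det_transpose]
    exact (mul_ne_zero (mul_ne_zero (hdetφ p hp) (hdet p hp)) (hdetφ p hp)).isUnit
  set Γ : Fin n → Mat n := fun i => (φ p)⁻¹ * (pdM i φ p + ω i p * φ p) with hΓ
  have hφΓ : ∀ i, φ p * Γ i = pdM i φ p + ω i p * φ p := fun i => by
    rw [hΓ]; exact Matrix.mul_nonsing_inv_cancel_left _ _ uφ
  have hΓs : ∀ a i j, Γ i a j = Γ j a i := by
    intro a i j
    simp only [hΓ, Matrix.mul_apply (M := (φ p)⁻¹)]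
    exact Finset.sum_congr rfl fun c _ => by rw [hcoh p hp c i j]
  have gsym : (g p)ᵀ = g p := by
    simp only [hg, Matrix.transpose_mul, Matrix.transpose_transpose, hsym p hp, Matrix.mul_assoc]
  have dφ := hφ.dm hV hp
  have dh := hh.dm hV hp
  have hdg : ∀ i, pdM i g p = (g p * Γ i)ᵀ + g p * Γ i := by
    intro i
    have e1 : pdM i φ p = φ p * Γ i - ω i p * φ p := by rw [hφΓ]; abel
    rw [hg, pdM_mul i (dφ.transpose.mul dh) dφ, pdM_mul i dφ.transpose dh, pdM_transpose, hmet p hp i,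
      e1]
    simp only [Matrix.transpose_mul, Matrix.transpose_sub, Matrix.transpose_transpose, hsym p hp,
      Matrix.mul_add, Matrix.add_mul, Matrix.mul_sub, Matrix.sub_mul, Matrix.mul_assoc]
    abel
  have c3 : ∀ l i j, (g p * Γ i) l j = (g p * Γ j) l i := by
    intro l i j
    simp only [Matrix.mul_apply (M := g p)]
    exact Finset.sum_congr rfl fun c _ => by rw [hΓs c i j]
  have hpd : ∀ i a b, pd i (fun q => g q a b) p = (g p * Γ i) b a + (g p * Γ i) a b := by
    intro i a b
    have := congrFun (congrFun (hdg i) a) b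
    exact this
  unfold christoffel
  simp only [hpd]
  have hl : ∀ m, (g p)⁻¹ l m * ((g p * Γ i) m j + (g p * Γ i) j m + ((g p * Γ j) m i + (g p * Γ j) i m)
      - ((g p * Γ m) j i + (g p * Γ m) i j)) = 2 * ((g p)⁻¹ l m * (g p * Γ i) m j) := by
    intro m
    rw [c3 m j i, c3 j m i, c3 i m j]
    ring
  simp only [hl]
  rw [← Finset.mul_sum, ← Matrix.mul_apply, Matrix.nonsing_inv_mul_cancel_left _ _ ug]
  ring

theorem riemann_eq {V : Set (Pt n)} (hV : IsOpen V) (h φ : Pt n → Mat n)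
    (ω : Fin n → Pt n → Mat n) (hh : SmM h V) (hφ : SmM φ V) (hω : ∀ i, SmM (ω i) V)
    (hsym : ∀ p ∈ V, (h p)ᵀ = h p) (hdet : ∀ p ∈ V, (h p).det ≠ 0)
    (hdetφ : ∀ p ∈ V, (φ p).det ≠ 0)
    (hmet : ∀ p ∈ V, ∀ i, pdM i h p = (ω i p)ᵀ * h p + h p * ω i p)
    (hcoh : ∀ p ∈ V, ∀ a i j, (pdM i φ p + ω i p * φ p) a j = (pdM j φ p + ω j p * φ p) a i) :
    ∀ p ∈ V, ∀ l i j k, riemann (fun q => (φ q)ᵀ * h q * φ q) l i j k p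
      = ((φ p)⁻¹ * curvM ω i j p * φ p) l k := by
  intro p hp l i j k
  have hchr := christoffel_eq hV h φ ω hh hφ hsym hdet hdetφ hmet hcoh
  have uφ : IsUnit (φ p).det := (hdetφ p hp).isUnit
  set Γ : Fin n → Pt n → Mat n := fun i q => (φ q)⁻¹ * (pdM i φ q + ω i q * φ q) with hΓ
  have hφΓ : ∀ i, ∀ q ∈ V, φ q * Γ i q = pdM i φ q + ω i q * φ q := fun i q hq => by
    rw [hΓ]; exact Matrix.mul_nonsing_inv_cancel_left _ _ (hdetφ q hq).isUnit
  have sΓ : ∀ i, SmM (Γ i) V := fun i => (hφ.inv hdetφ).mul ((hφ.pdM hV i).add ((hω i).mul hφ))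
  have hpdc : ∀ i l j k, pd i (christoffel (fun q => (φ q)ᵀ * h q * φ q) l j k) p
      = pdM i (Γ j) p l k := fun i l j k => pd_congr hV hp (fun q hq => hchr q hq l j k) i
  have e0 : riemann (fun q => (φ q)ᵀ * h q * φ q) l i j k p = (curvM Γ i j p) l k := by
    unfold riemann curvM
    simp only [hpdc, hchr p hp, Finset.sum_sub_distrib, Matrix.add_apply, Matrix.sub_apply]
    rw [← Matrix.mul_apply, ← Matrix.mul_apply]
  rw [e0]
  have dφ := hφ.dm hV hp
  have key : ∀ i j, φ p * pdM i (Γ j) p = pdM i (pdM j φ) p + pdM i (ω j) p * φ p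
      + ω j p * (φ p * Γ i p - ω i p * φ p) - (φ p * Γ i p - ω i p * φ p) * Γ j p := by
    intro i j
    have e1 : pdM i φ p = φ p * Γ i p - ω i p * φ p := by rw [hφΓ i p hp]; abel
    have e2 := pdM_congr hV hp (hφΓ j) i
    rw [pdM_mul i dφ ((sΓ j).dm hV hp), pdM_add i ((hφ.pdM hV j).dm hV hp)
      (((hω j).dm hV hp).mul dφ), pdM_mul i ((hω j).dm hV hp) dφ, e1] at e2
    rw [← add_assoc] at e2
    rw [← e2]; abel
  have e3 : φ p * curvM Γ i j p = curvM ω i j p * φ p := by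
    simp only [curvM, Matrix.mul_add, Matrix.mul_sub, key, pdM_comm hV hφ hp i j, Matrix.add_mul,
      Matrix.sub_mul, Matrix.mul_assoc]
    abel
  have e4 : curvM Γ i j p = (φ p)⁻¹ * curvM ω i j p * φ p := by
    rw [Matrix.mul_assoc, ← e3, Matrix.nonsing_inv_mul_cancel_left _ _ uφ]
  rw [e4]

/-- The `i`-th column as a column matrix. -/
def colM (F : Pt n → Mat n) (i : Fin n) (q : Pt n) : Matrix (Fin n) Unit ℝ :=
  Matrix.of fun a _ => F q a i

theorem SmM.colM {F : Pt n → Mat n} {V : Set (Pt n)} (hF : SmM F V) (i : Fin n) :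
    SmM (Loc.colM F i) V := fun a _ => hF a i

theorem unit_smul (N : Matrix Unit Unit ℝ) : N = (N () ()) • (1 : Matrix Unit Unit ℝ) := by
  ext a b; simp

/-- Algebraic core of the conformal change of curvature. -/
theorem conf_alg (X Z B : Fin n → Matrix (Fin n) Unit ℝ) (T : Matrix (Fin n) Unit ℝ) (h : Mat n)
    (c : ℝ) (s : Fin n → ℝ) (hsym : hᵀ = h) (hs : ∀ i, (X i)ᵀ * h * T = s i • 1)
    (hT : Tᵀ * h * T = (2 * c) • 1) (hB : ∀ i, B i = - c • X i + Z i + s i • T) (i j : Fin n) :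
    (Z i * (X j)ᵀ - X j * (Z i)ᵀ + X i * (Z j)ᵀ - Z j * (X i)ᵀ) * h
      + ((X j * (B i)ᵀ - B i * (X j)ᵀ) - (X i * (B j)ᵀ - B j * (X i)ᵀ)) * h
      + ((X i * Tᵀ - T * (X i)ᵀ) * h * ((X j * Tᵀ - T * (X j)ᵀ) * h)
        - (X j * Tᵀ - T * (X j)ᵀ) * h * ((X i * Tᵀ - T * (X i)ᵀ) * h)) = 0 := by
  have s1 : ∀ i (N : Matrix Unit (Fin n) ℝ), (X i)ᵀ * (h * (T * N)) = s i • N := by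
    intro i N
    rw [← Matrix.mul_assoc, ← Matrix.mul_assoc, hs, Matrix.smul_mul, Matrix.one_mul]
  have hs' : ∀ i, Tᵀ * h * X i = s i • 1 := by
    intro i
    have := congrArg Matrix.transpose (hs i)
    simpa [Matrix.transpose_mul, hsym, Matrix.mul_assoc] using this
  have s2 : ∀ i (N : Matrix Unit (Fin n) ℝ), Tᵀ * (h * (X i * N)) = s i • N := by
    intro i N
    rw [← Matrix.mul_assoc, ← Matrix.mul_assoc, hs', Matrix.smul_mul, Matrix.one_mul]
  have s3 : ∀ (N : Matrix Unit (Fin n) ℝ), Tᵀ * (h * (T * N)) = (2 * c) • N := by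
    intro N
    rw [← Matrix.mul_assoc, ← Matrix.mul_assoc, hT, Matrix.smul_mul, Matrix.one_mul]
  set γ := ((X i)ᵀ * h * X j) () () with hγ
  have g1 : (X i)ᵀ * h * X j = γ • 1 := unit_smul _
  have g2 : (X j)ᵀ * h * X i = γ • 1 := by
    have := congrArg Matrix.transpose g1
    simpa [Matrix.transpose_mul, hsym, Matrix.mul_assoc] using this
  have s4 : ∀ (N : Matrix Unit (Fin n) ℝ), (X i)ᵀ * (h * (X j * N)) = γ • N := by
    intro N
    rw [← Matrix.mul_assoc, ← Matrix.mul_assoc, g1, Matrix.smul_mul, Matrix.one_mul]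
  have s5 : ∀ (N : Matrix Unit (Fin n) ℝ), (X j)ᵀ * (h * (X i * N)) = γ • N := by
    intro N
    rw [← Matrix.mul_assoc, ← Matrix.mul_assoc, g2, Matrix.smul_mul, Matrix.one_mul]
  simp only [hB, Matrix.transpose_add, Matrix.transpose_smul, Matrix.mul_add, Matrix.add_mul,
    Matrix.mul_sub, Matrix.sub_mul, Matrix.mul_assoc, Matrix.smul_mul, Matrix.mul_smul,
    s1, s2, s3, s4, s5]
  module

/-- Conformal flatness from a suitable solution `(σ, T)`. -/
theorem conf_flat {V : Set (Pt n)} (hV : IsOpen V) (h ξ ζ : Pt n → Mat n)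
    (ω : Fin n → Pt n → Mat n) (hh : SmM h V) (hξ : SmM ξ V) (hω : ∀ i, SmM (ω i) V)
    (hsym : ∀ p ∈ V, (h p)ᵀ = h p) (hdet : ∀ p ∈ V, (h p).det ≠ 0)
    (hdetξ : ∀ p ∈ V, (ξ p).det ≠ 0)
    (hmet : ∀ p ∈ V, ∀ i, pdM i h p = (ω i p)ᵀ * h p + h p * ω i p)
    (hcoh : ∀ p ∈ V, ∀ i j, pdM i (colM ξ j) p + ω i p * colM ξ j p
      = pdM j (colM ξ i) p + ω j p * colM ξ i p)
    (hgauss : ∀ p ∈ V, ∀ i j, curvM ω i j p =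
      (colM ζ i p * (colM ξ j p)ᵀ - colM ξ j p * (colM ζ i p)ᵀ + colM ξ i p * (colM ζ j p)ᵀ
        - colM ζ j p * (colM ξ i p)ᵀ) * h p)
    (σ c : Pt n → ℝ) (T : Pt n → Matrix (Fin n) Unit ℝ)
    (hσ : ContDiffOn ℝ (⊤ : ℕ∞) σ V) (sT : SmM T V)
    (hdσ : ∀ p ∈ V, ∀ i, (colM ξ i p)ᵀ * h p * T p = pd i σ p • 1)
    (hc : ∀ p ∈ V, (T p)ᵀ * h p * T p = (2 * c p) • 1)
    (hdT : ∀ p ∈ V, ∀ i, pdM i T p = - c p • colM ξ i p + colM ζ i p + pd i σ p • T p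
      - ω i p * T p) :
    FlatOn (fun q => Real.exp (2 * σ q) • ((ξ q)ᵀ * h q * ξ q)) V := by
  set θ : Fin n → Pt n → Mat n := fun i q =>
    (colM ξ i q * (T q)ᵀ - T q * (colM ξ i q)ᵀ) * h q with hθ
  set φ : Pt n → Mat n := fun q => Real.exp (σ q) • ξ q with hφ
  have sθ : ∀ i, SmM (θ i) V := fun i =>
    (((hξ.colM i).mul sT.transpose).sub (sT.mul (hξ.colM i).transpose)).mul hh
  have hE : ContDiffOn ℝ (⊤ : ℕ∞) (fun q => Real.exp (σ q)) V := hσ.exp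
  have hgeq : (fun q => Real.exp (2 * σ q) • ((ξ q)ᵀ * h q * ξ q))
      = fun q => (φ q)ᵀ * h q * φ q := by
    funext q
    simp only [hφ, Matrix.transpose_smul, Matrix.smul_mul, Matrix.mul_smul, smul_smul]
    rw [two_mul, Real.exp_add]
  rw [hgeq]
  intro p hp l i j k
  rw [riemann_eq hV h φ (fun i q => ω i q + θ i q) hh (SmM.smul hE hξ) (fun i => (hω i).add (sθ i))
    hsym hdet ?_ ?_ ?_ p hp]
  · -- curvature vanishes
    suffices hz : curvM (fun i q => ω i q + θ i q) i j p = 0 by rw [hz]; simp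
    have dX : ∀ i, DM (colM ξ i) p := fun i => (hξ.colM i).dm hV hp
    have dT : DM T p := sT.dm hV hp
    have dh : DM h p := hh.dm hV hp
    have dω : ∀ i, DM (ω i) p := fun i => (hω i).dm hV hp
    have dθ : ∀ i, DM (θ i) p := fun i => (sθ i).dm hV hp
    set B : Fin n → Matrix (Fin n) Unit ℝ := fun i =>
      - c p • colM ξ i p + colM ζ i p + pd i σ p • T p with hB
    have hpT : ∀ i, pdM i T p = B i - ω i p * T p := fun i => hdT p hp i
    have hpθ : ∀ i j, pdM i (θ j) p = ((pdM i (colM ξ j) p * (T p)ᵀ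
        + colM ξ j p * (B i - ω i p * T p)ᵀ)
        - ((B i - ω i p * T p) * (colM ξ j p)ᵀ + T p * (pdM i (colM ξ j) p)ᵀ)) * h p
        + (colM ξ j p * (T p)ᵀ - T p * (colM ξ j p)ᵀ) * ((ω i p)ᵀ * h p + h p * ω i p) := by
      intro i j
      rw [hθ, pdM_mul i (((dX j).mul dT.transpose).sub (dT.mul (dX j).transpose)) dh,
        pdM_sub i ((dX j).mul dT.transpose) (dT.mul (dX j).transpose),
        pdM_mul i (dX j) dT.transpose, pdM_mul i dT (dX j).transpose, pdM_transpose, pdM_transpose,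
        hpT, hmet p hp]
    have hX : pdM i (colM ξ j) p = pdM j (colM ξ i) p + ω j p * colM ξ i p - ω i p * colM ξ j p := by
      rw [← hcoh p hp i j]; abel
    have alg := conf_alg (fun i => colM ξ i p) (fun i => colM ζ i p) B (T p) (h p) (c p)
      (fun i => pd i σ p) (hsym p hp) (hdσ p hp) (hc p hp) (fun i => rfl) i j
    have hg := hgauss p hp i j
    rw [← hg] at alg
    rw [← alg]
    clear_value B
    simp only [curvM, pdM_add _ (dω _) (dθ _), hpθ, hX]
    simp only [hθ, Matrix.transpose_add, Matrix.transpose_sub, Matrix.transpose_mul, Matrix.mul_add,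
      Matrix.add_mul, Matrix.mul_sub, Matrix.sub_mul, Matrix.mul_assoc]
    abel
  · intro q hq
    simp only [hφ, Matrix.det_smul]
    exact mul_ne_zero (pow_ne_zero _ (Real.exp_ne_zero _)) (hdetξ q hq)
  · intro q hq i
    rw [hmet q hq i]
    simp only [hθ, Matrix.transpose_add, Matrix.transpose_sub, Matrix.transpose_mul,
      Matrix.transpose_transpose, Matrix.mul_add, hsym q hq,
      Matrix.add_mul, Matrix.mul_sub, Matrix.sub_mul, Matrix.mul_assoc]
    abel
  · intro q hq a i j
    have dX : ∀ i, DM (colM ξ i) q := fun i => (hξ.colM i).dm hV hq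
    have dE := sm_diffAt hV hE hq
    have hpE : ∀ i, pd i (fun q => Real.exp (σ q)) q = Real.exp (σ q) * pd i σ q := by
      intro i
      unfold pd
      rw [((sm_diffAt hV hσ hq).hasFDerivAt.exp).fderiv]
      simp
    have hcol : ∀ i j, (pdM i φ q + (ω i q + θ i q) * φ q) a j
        = (pdM i (fun q => Real.exp (σ q) • colM ξ j q) q
          + (ω i q + θ i q) * (Real.exp (σ q) • colM ξ j q)) a () := by
      intro i j; rfl
    rw [hcol, hcol]
    refine congrFun (congrFun ?_ a) ()
    rw [pdM_smul i dE (dX j), pdM_smul j dE (dX i), hpE, hpE]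
    have hX : pdM i (colM ξ j) q = pdM j (colM ξ i) q + ω j q * colM ξ i q - ω i q * colM ξ j q := by
      rw [← hcoh q hq i j]; abel
    set γ := ((colM ξ i q)ᵀ * h q * colM ξ j q) () () with hγ
    have g1 : (colM ξ i q)ᵀ * h q * colM ξ j q = γ • 1 := unit_smul _
    have g2 : (colM ξ j q)ᵀ * h q * colM ξ i q = γ • 1 := by
      have := congrArg Matrix.transpose g1
      simpa [Matrix.transpose_mul, hsym q hq, Matrix.mul_assoc] using this
    have hs' : ∀ i, (T q)ᵀ * h q * colM ξ i q = pd i σ q • 1 := by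
      intro i
      have := congrArg Matrix.transpose (hdσ q hq i)
      simpa [Matrix.transpose_mul, hsym q hq, Matrix.mul_assoc] using this
    rw [Matrix.mul_assoc] at g1 g2
    simp only [Matrix.mul_assoc] at hs'
    rw [hX]
    simp only [hθ, Matrix.add_mul, Matrix.sub_mul, Matrix.mul_smul, Matrix.mul_assoc, g1, g2, hs',
      Matrix.mul_one]
    clear_value γ
    generalize ω i q * colM ξ j q = a1
    generalize ω j q * colM ξ i q = a2
    generalize pdM j (colM ξ i) q = a3
    generalize colM ξ i q = a4
    generalize colM ξ j q = a5
    generalize T q = a6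
    simp only [smul_add, smul_sub, smul_smul]
    abel

end geometry
end Loc
end


noncomputable section
namespace Loc
open Matrix Set Metric Topology
set_option maxSynthPendingDepth 3

section tractor
variable {n : ℕ}

/-- Connection matrices of the tractor connection. -/
def trM (h ξ ζ : Pt n → Mat n) (ω : Fin n → Pt n → Mat n) (i : Fin n) (q : Pt n) :
    Matrix (Fin n ⊕ (Unit ⊕ Unit)) (Fin n ⊕ (Unit ⊕ Unit)) ℝ :=
  fromBlocks (- ω i q) (fromCols (- colM ζ i q) (colM ξ i q))
    (fromRows ((colM ξ i q)ᵀ * h q) (- ((colM ζ i q)ᵀ * h q))) 0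

theorem trM_sm {V : Set (Pt n)} {h ξ ζ : Pt n → Mat n} {ω : Fin n → Pt n → Mat n}
    (hh : SmM h V) (hξ : SmM ξ V) (hζ : SmM ζ V) (hω : ∀ i, SmM (ω i) V) (i : Fin n) :
    SmM (trM h ξ ζ ω i) V := by
  have s1 := (hω i).neg
  have s2 := (hζ.colM i).neg
  have s3 := hξ.colM i
  have s4 := (hξ.colM i).transpose.mul hh
  have s5 := ((hζ.colM i).transpose.mul hh).neg
  rintro (a | a | a) (b | b | b)
  · exact s1 a b
  · exact s2 a b
  · exact s3 a b
  · exact s4 a b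
  · exact contDiffOn_const
  · exact contDiffOn_const
  · exact s5 a b
  · exact contDiffOn_const
  · exact contDiffOn_const

theorem pdM_trM {V : Set (Pt n)} (hV : IsOpen V) {h ξ ζ : Pt n → Mat n} {ω : Fin n → Pt n → Mat n}
    (hh : SmM h V) (hξ : SmM ξ V) (hζ : SmM ζ V)
    (hmet : ∀ p ∈ V, ∀ i, pdM i h p = (ω i p)ᵀ * h p + h p * ω i p)
    {p : Pt n} (hp : p ∈ V) (i j : Fin n) :
    pdM i (trM h ξ ζ ω j) p = fromBlocks (- pdM i (ω j) p)
      (fromCols (- pdM i (colM ζ j) p) (pdM i (colM ξ j) p))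
      (fromRows ((pdM i (colM ξ j) p)ᵀ * h p + (colM ξ j p)ᵀ * ((ω i p)ᵀ * h p + h p * ω i p))
        (- ((pdM i (colM ζ j) p)ᵀ * h p + (colM ζ j p)ᵀ * ((ω i p)ᵀ * h p + h p * ω i p)))) 0 := by
  have dX := (hξ.colM j).dm hV hp
  have dZ := (hζ.colM j).dm hV hp
  have dh := hh.dm hV hp
  rw [← hmet p hp i, ← pdM_transpose, ← pdM_transpose, ← pdM_mul i dX.transpose dh,
    ← pdM_mul i dZ.transpose dh, ← pdM_neg, ← pdM_neg, ← pdM_neg]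
  have z : pd i (fun _ : Pt n => (0:ℝ)) p = 0 := by simp [pd]
  ext (a | a | a) (b | b | b)
  · rfl
  · rfl
  · rfl
  · rfl
  · exact z
  · exact z
  · rfl
  · exact z
  · exact z

theorem trM_flat {V : Set (Pt n)} (hV : IsOpen V) {h ξ ζ : Pt n → Mat n}
    {ω : Fin n → Pt n → Mat n}
    (hh : SmM h V) (hξ : SmM ξ V) (hζ : SmM ζ V)
    (hsym : ∀ p ∈ V, (h p)ᵀ = h p)
    (hmet : ∀ p ∈ V, ∀ i, pdM i h p = (ω i p)ᵀ * h p + h p * ω i p)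
    (hcoh : ∀ p ∈ V, ∀ i j, pdM i (colM ξ j) p + ω i p * colM ξ j p
      = pdM j (colM ξ i) p + ω j p * colM ξ i p)
    (hcoz : ∀ p ∈ V, ∀ i j, pdM i (colM ζ j) p + ω i p * colM ζ j p
      = pdM j (colM ζ i) p + ω j p * colM ζ i p)
    (hcomp : ∀ p ∈ V, ∀ i j, (colM ξ i p)ᵀ * h p * colM ζ j p = (colM ξ j p)ᵀ * h p * colM ζ i p)
    (hgauss : ∀ p ∈ V, ∀ i j, curvM ω i j p =
      (colM ζ i p * (colM ξ j p)ᵀ - colM ξ j p * (colM ζ i p)ᵀ + colM ξ i p * (colM ζ j p)ᵀ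
        - colM ζ j p * (colM ξ i p)ᵀ) * h p) :
    ∀ p ∈ V, ∀ i j, pdM i (trM h ξ ζ ω j) p + trM h ξ ζ ω j p * trM h ξ ζ ω i p
      = pdM j (trM h ξ ζ ω i) p + trM h ξ ζ ω i p * trM h ξ ζ ω j p := by
  intro p hp i j
  have us : ∀ N : Matrix Unit Unit ℝ, Nᵀ = N := fun N => by ext a b; rfl
  have hcomp' : ∀ i j, (colM ζ i p)ᵀ * h p * colM ξ j p = (colM ζ j p)ᵀ * h p * colM ξ i p := by
    intro i j
    have := congrArg Matrix.transpose (hcomp p hp i j)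
    simp only [Matrix.transpose_mul, Matrix.transpose_transpose, hsym p hp] at this
    simp only [Matrix.mul_assoc]
    exact this.symm
  have gs : ∀ F : Pt n → Mat n, (colM F i p)ᵀ * h p * colM F j p
      = (colM F j p)ᵀ * h p * colM F i p := by
    intro F
    rw [← us ((colM F i p)ᵀ * h p * colM F j p)]
    simp only [Matrix.transpose_mul, Matrix.transpose_transpose, hsym p hp, Matrix.mul_assoc]
  rw [pdM_trM hV hh hξ hζ hmet hp, pdM_trM hV hh hξ hζ hmet hp]
  have hX : pdM i (colM ξ j) p = pdM j (colM ξ i) p + ω j p * colM ξ i p - ω i p * colM ξ j p := by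
    rw [← hcoh p hp i j]; abel
  have hZ : pdM i (colM ζ j) p = pdM j (colM ζ i) p + ω j p * colM ζ i p - ω i p * colM ζ j p := by
    rw [← hcoz p hp i j]; abel
  have hg := hgauss p hp i j
  unfold curvM at hg
  have hG : pdM i (ω j) p = pdM j (ω i) p - (ω i p * ω j p - ω j p * ω i p) +
      (colM ζ i p * (colM ξ j p)ᵀ - colM ξ j p * (colM ζ i p)ᵀ + colM ξ i p * (colM ζ j p)ᵀ
        - colM ζ j p * (colM ξ i p)ᵀ) * h p := by
    rw [← hg]; abel
  unfold trM
  simp only [fromBlocks_multiply, fromBlocks_add]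
  congr 1
  · rw [hG, fromCols_mul_fromRows, fromCols_mul_fromRows]
    simp only [Matrix.add_mul, Matrix.sub_mul, Matrix.mul_assoc, Matrix.neg_mul, Matrix.mul_neg]
    abel
  · rw [hX, hZ]
    simp only [mul_fromCols, Matrix.mul_zero, add_zero]
    ext a (b | b)
    · simp only [Matrix.add_apply, fromCols_apply_inl, Matrix.neg_apply, Matrix.neg_mul,
        Matrix.mul_neg, Matrix.sub_apply]
      ring
    · simp only [Matrix.add_apply, fromCols_apply_inr, Matrix.neg_apply, Matrix.neg_mul,
        Matrix.mul_neg, Matrix.sub_apply]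
      ring
  · rw [hX, hZ]
    simp only [fromRows_mul, Matrix.zero_mul, add_zero]
    ext (a | a) b
    · simp only [Matrix.add_apply, fromRows_apply_inl, Matrix.neg_apply, Matrix.neg_mul,
        Matrix.mul_neg, Matrix.sub_apply, Matrix.transpose_add, Matrix.transpose_sub,
        Matrix.transpose_mul, Matrix.add_mul, Matrix.sub_mul, Matrix.mul_add, Matrix.mul_assoc]
      ring
    · simp only [Matrix.add_apply, fromRows_apply_inr, Matrix.neg_apply, Matrix.neg_mul,
        Matrix.mul_neg, Matrix.sub_apply, Matrix.transpose_add, Matrix.transpose_sub,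
        Matrix.transpose_mul, Matrix.add_mul, Matrix.sub_mul, Matrix.mul_add, Matrix.mul_assoc]
      ring
  · simp only [Matrix.mul_zero, zero_add, add_zero, fromRows_mul_fromCols, Matrix.neg_mul,
      Matrix.mul_neg, gs, hcomp p hp j i, hcomp' j i]

theorem conf_flat_local {V : Set (Pt n)} (hV : IsOpen V) {h ξ ζ : Pt n → Mat n}
    {ω : Fin n → Pt n → Mat n}
    (hh : SmM h V) (hξ : SmM ξ V) (hζ : SmM ζ V) (hω : ∀ i, SmM (ω i) V)
    (hsym : ∀ p ∈ V, (h p)ᵀ = h p) (hdet : ∀ p ∈ V, (h p).det ≠ 0)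
    (hdetξ : ∀ p ∈ V, (ξ p).det ≠ 0)
    (hmet : ∀ p ∈ V, ∀ i, pdM i h p = (ω i p)ᵀ * h p + h p * ω i p)
    (hcoh : ∀ p ∈ V, ∀ i j, pdM i (colM ξ j) p + ω i p * colM ξ j p
      = pdM j (colM ξ i) p + ω j p * colM ξ i p)
    (hcoz : ∀ p ∈ V, ∀ i j, pdM i (colM ζ j) p + ω i p * colM ζ j p
      = pdM j (colM ζ i) p + ω j p * colM ζ i p)
    (hcomp : ∀ p ∈ V, ∀ i j, (colM ξ i p)ᵀ * h p * colM ζ j p = (colM ξ j p)ᵀ * h p * colM ζ i p)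
    (hgauss : ∀ p ∈ V, ∀ i j, curvM ω i j p =
      (colM ζ i p * (colM ξ j p)ᵀ - colM ξ j p * (colM ζ i p)ᵀ + colM ξ i p * (colM ζ j p)ᵀ
        - colM ζ j p * (colM ξ i p)ᵀ) * h p) :
    ConformallyFlatOn (fun q => (ξ q)ᵀ * h q * ξ q) V := by
  intro p hp
  obtain ⟨r, hr, hrV, Y, hY0, sY, hY⟩ := exists_parallel (trM h ξ ζ ω) hV
    (trM_sm hh hξ hζ hω) (trM_flat hV hh hξ hζ hsym hmet hcoh hcoz hcomp hgauss) p hp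
    (Sum.elim (fun _ => 0) (Sum.elim (fun _ => 1) (fun _ => 0)))
  set w : Pt n → Matrix (Fin n) Unit ℝ := fun q => Matrix.of fun a _ => Y q (Sum.inl a) () with hw
  set u : Pt n → ℝ := fun q => Y q (Sum.inr (Sum.inl ())) () with hu
  set v : Pt n → ℝ := fun q => Y q (Sum.inr (Sum.inr ())) () with hv
  have us : ∀ N : Matrix Unit Unit ℝ, Nᵀ = N := fun N => by ext a b; rfl
  have hYb : ∀ q, Y q = fromRows (w q) (fromRows (u q • 1) (v q • 1)) := by
    intro q
    ext (a | a | a) b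
    · rfl
    · simp [hu]
    · simp [hv]
  have sw : SmM w (ball p r) := fun a b => sY (Sum.inl a) ()
  have su : ContDiffOn ℝ (⊤ : ℕ∞) u (ball p r) := sY _ _
  have sv : ContDiffOn ℝ (⊤ : ℕ∞) v (ball p r) := sY _ _
  have hMY : ∀ q i, trM h ξ ζ ω i q * Y q = fromRows
      (- (ω i q * w q) - u q • colM ζ i q + v q • colM ξ i q)
      (fromRows ((colM ξ i q)ᵀ * h q * w q) (- ((colM ζ i q)ᵀ * h q * w q))) := by
    intro q i
    rw [hYb q]
    unfold trM
    rw [fromBlocks_mul_fromRows, fromCols_mul_fromRows, fromRows_mul]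
    simp only [Matrix.neg_mul, Matrix.mul_smul, Matrix.mul_one, Matrix.zero_mul, add_zero]
    congr 1
    rw [smul_neg]; abel
  have dw : ∀ q ∈ ball p r, ∀ i, pdM i w q = - (ω i q * w q) - u q • colM ζ i q
      + v q • colM ξ i q := by
    intro q hq i
    have := hY q hq i
    rw [hMY] at this
    ext a b
    exact congrFun (congrFun this (Sum.inl a)) ()
  have du : ∀ q ∈ ball p r, ∀ i, pd i u q = ((colM ξ i q)ᵀ * h q * w q) () () := by
    intro q hq i
    have := hY q hq i
    rw [hMY] at this
    exact congrFun (congrFun this (Sum.inr (Sum.inl ()))) ()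
  have dv : ∀ q ∈ ball p r, ∀ i, pd i v q = - ((colM ζ i q)ᵀ * h q * w q) () () := by
    intro q hq i
    have := hY q hq i
    rw [hMY] at this
    exact congrFun (congrFun this (Sum.inr (Sum.inr ()))) ()
  -- conserved quantity
  have hcons : ∀ q ∈ ball p r, (w q)ᵀ * h q * w q = (2 * (u q * v q)) • 1 := by
    set K : Pt n → Matrix Unit Unit ℝ := fun q => (w q)ᵀ * h q * w q - (2 * (u q * v q)) • 1
      with hK
    have hh' := hh.mono hrV
    have suv : ContDiffOn ℝ (⊤ : ℕ∞) (fun q => 2 * (u q * v q)) (ball p r) :=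
      contDiffOn_const.mul (su.mul sv)
    have s1 : SmM (fun _ : Pt n => (1 : Matrix Unit Unit ℝ)) (ball p r) :=
      fun _ _ => contDiffOn_const
    have sK : SmM K (ball p r) :=
      ((sw.transpose.mul hh').mul sw).sub (SmM.smul suv s1)
    have dK : ∀ q ∈ ball p r, ∀ i, pdM i K q = 0 := by
      intro q hq i
      have Dw := sw.dm isOpen_ball hq
      have Dh := hh'.dm isOpen_ball hq
      have Du := sm_diffAt isOpen_ball su hq
      have Dv := sm_diffAt isOpen_ball sv hq
      have e1 : pdM i (fun _ : Pt n => (1 : Matrix Unit Unit ℝ)) q = 0 := by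
        ext a b; simp [pdM, pd]
      have e2 : pd i (fun q => 2 * (u q * v q)) q = 2 * (pd i u q * v q + u q * pd i v q) := by
        rw [pd_mul i (differentiableAt_const _) (Du.fun_mul Dv), pd_mul i Du Dv]
        simp [pd]
      have x1 : (w q)ᵀ * h q * colM ξ i q = (colM ξ i q)ᵀ * h q * w q := by
        rw [← us ((w q)ᵀ * h q * colM ξ i q)]
        simp only [Matrix.transpose_mul, Matrix.transpose_transpose, hsym q (hrV hq),
          Matrix.mul_assoc]
      have x2 : (w q)ᵀ * h q * colM ζ i q = (colM ζ i q)ᵀ * h q * w q := by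
        rw [← us ((w q)ᵀ * h q * colM ζ i q)]
        simp only [Matrix.transpose_mul, Matrix.transpose_transpose, hsym q (hrV hq),
          Matrix.mul_assoc]
      rw [hK, pdM_sub i ((Dw.transpose.mul Dh).mul Dw) ((SmM.smul suv s1).dm isOpen_ball hq),
        pdM_mul i (Dw.transpose.mul Dh) Dw, pdM_mul i Dw.transpose Dh, pdM_transpose,
        pdM_smul i (sm_diffAt isOpen_ball suv hq) (s1.dm isOpen_ball hq), e1, e2, dw q hq,
        hmet q (hrV hq), du q hq, dv q hq]
      rw [Matrix.mul_assoc] at x1 x2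
      have y1 := unit_smul ((colM ξ i q)ᵀ * h q * w q)
      have y2 := unit_smul ((colM ζ i q)ᵀ * h q * w q)
      generalize ((colM ξ i q)ᵀ * h q * w q) () () = t1 at *
      generalize ((colM ζ i q)ᵀ * h q * w q) () () = t2 at *
      rw [y1] at x1
      rw [y2] at x2
      rw [Matrix.mul_assoc] at y1 y2
      simp only [Matrix.transpose_add, Matrix.transpose_sub, Matrix.transpose_neg,
        Matrix.transpose_smul, Matrix.transpose_mul, Matrix.mul_add, Matrix.add_mul,
        Matrix.mul_sub, Matrix.sub_mul, Matrix.mul_assoc, Matrix.neg_mul, Matrix.mul_neg,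
        Matrix.smul_mul, Matrix.mul_smul, x1, x2, y1, y2]
      module
    have cK : ∀ q ∈ ball p r, K q () () = K p () () := by
      intro q hq
      refine isOpen_ball.is_const_of_fderiv_eq_zero (convex_ball p r).isPreconnected
        (fun x hx => (sm_diffAt isOpen_ball (sK () ()) hx).differentiableWithinAt) ?_ hq
        (mem_ball_self hr)
      intro x hx
      ext z
      rw [fderiv_eq_sum]
      have : ∀ i, pd i (fun q => K q () ()) x = 0 := fun i =>
        congrFun (congrFun (dK x hx i) ()) ()
      simp [this]
    have K0 : K p () () = 0 := by
      have w0 : w p = 0 := by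
        ext a b
        exact hY0 (Sum.inl a)
      have v0 : v p = 0 := hY0 (Sum.inr (Sum.inr ()))
      simp [hK, w0, v0]
    intro q hq
    have := cK q hq
    rw [K0] at this
    have hz : K q = 0 := by ext a b; exact this
    exact sub_eq_zero.mp hz
  set W : Set (Pt n) := ball p r ∩ Set.preimage u (Ioi 0) with hWd
  have hW : IsOpen W := su.continuousOn.isOpen_inter_preimage isOpen_ball isOpen_Ioi
  have hWb : W ⊆ ball p r := inter_subset_left
  have hWV : W ⊆ V := hWb.trans hrV
  have u0 : u p = 1 := hY0 (Sum.inr (Sum.inl ()))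
  have hpos : ∀ q ∈ W, 0 < u q := fun q hq => hq.2
  have hne : ∀ q ∈ W, u q ≠ 0 := fun q hq => (hpos q hq).ne'
  refine ⟨W, hW, ⟨mem_ball_self hr, by simp [u0]⟩, hWV, fun q => - Real.log (u q), ?_, ?_⟩
  · exact ((su.mono hWb).log hne).neg
  have sinv : ContDiffOn ℝ (⊤ : ℕ∞) (fun q => - (u q)⁻¹) W := ((su.mono hWb).inv hne).neg
  have dlog : ∀ q ∈ W, ∀ i, pd i (fun q => - Real.log (u q)) q = - (u q)⁻¹ * pd i u q := by
    intro q hq i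
    have := ((sm_diffAt isOpen_ball su (hWb hq)).hasFDerivAt.log (hne q hq)).fun_neg
    unfold pd
    rw [this.fderiv]
    simp
  have dinv : ∀ q ∈ W, ∀ i, pd i (fun q => - (u q)⁻¹) q = (u q)⁻¹ * (u q)⁻¹ * pd i u q := by
    intro q hq i
    have := ((hasDerivAt_inv (hne q hq)).comp_hasFDerivAt q
      (sm_diffAt isOpen_ball su (hWb hq)).hasFDerivAt).fun_neg
    unfold pd
    erw [this.fderiv]
    simp
    left; ring
  refine conf_flat hW h ξ ζ ω (hh.mono hWV) (hξ.mono hWV) (fun i => (hω i).mono hWV)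
    (fun q hq => hsym q (hWV hq)) (fun q hq => hdet q (hWV hq)) (fun q hq => hdetξ q (hWV hq))
    (fun q hq => hmet q (hWV hq)) (fun q hq => hcoh q (hWV hq)) (fun q hq => hgauss q (hWV hq))
    (fun q => - Real.log (u q)) (fun q => v q * (u q)⁻¹) (fun q => (- (u q)⁻¹) • w q)
    (((su.mono hWb).log hne).neg) (SmM.smul sinv (sw.mono hWb)) ?_ ?_ ?_
  · intro q hq i
    rw [dlog q hq, du q (hWb hq), Matrix.mul_smul, unit_smul ((colM ξ i q)ᵀ * h q * w q)]
    simp [smul_smul]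
  · intro q hq
    rw [Matrix.transpose_smul, Matrix.smul_mul, Matrix.smul_mul, Matrix.mul_smul,
      hcons q (hWb hq), smul_smul, smul_smul]
    congr 1
    have := hne q hq
    field_simp
  · intro q hq i
    rw [pdM_smul i (sm_diffAt hW sinv hq) (sw.dm isOpen_ball (hWb hq)), dlog q hq, dinv q hq,
      dw q (hWb hq), Matrix.mul_smul]
    have e : (u q)⁻¹ * u q = 1 := inv_mul_cancel₀ (hne q hq)
    generalize ω i q * w q = a1
    generalize colM ξ i q = a2
    generalize colM ζ i q = a3
    have e3 : a3 = ((u q)⁻¹ * u q) • a3 := by rw [e, one_smul]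
    have : a3 + 0 = ((u q)⁻¹ * u q) • a3 := by rw [add_zero]; exact e3
    ext a b
    simp only [Matrix.add_apply, Matrix.sub_apply, Matrix.smul_apply, Matrix.neg_apply, smul_eq_mul]
    linear_combination (a3 a b) * e

end tractor
end Loc
end


noncomputable section
namespace Loc
open Matrix Set Metric Topology
set_option maxSynthPendingDepth 3

section main
variable {n : ℕ}

theorem schouten_alg (hn : 3 ≤ n) {g : Pt n → Mat n} {p : Pt n} {Q A : Mat n}
    (hA : g p * Q = A) (hAs : Aᵀ = A) (hgs : (g p)ᵀ = g p) (hu : IsUnit (g p).det)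
    (hR : ∀ l i j k, riemann g l i j k p = Q l i * g p j k - (1 : Mat n) l j * A i k
      + (1 : Mat n) l i * A j k - Q l j * g p i k) :
    schouten g p = A := by
  have hn2 : (n : ℝ) - 2 ≠ 0 := by
    have : (3 : ℝ) ≤ n := by exact_mod_cast hn
    linarith
  have hn1 : (n : ℝ) - 1 ≠ 0 := by
    have : (3 : ℝ) ≤ n := by exact_mod_cast hn
    linarith
  have hQg : Qᵀ * g p = A := by
    have := congrArg Matrix.transpose hA
    rwa [Matrix.transpose_mul, hgs, hAs] at this
  have hric : ∀ j k, ricci g j k p = ((n : ℝ) - 2) * A j k + Q.trace * g p j k := by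
    intro j k
    unfold ricci
    simp only [hR, Finset.sum_add_distrib, Finset.sum_sub_distrib]
    have e1 : ∑ i, Q i i * g p j k = Q.trace * g p j k := by
      rw [← Finset.sum_mul]; rfl
    have e2 : ∑ i, (1 : Mat n) i j * A i k = A j k := by
      simp [Matrix.one_apply]
    have e3 : ∑ i : Fin n, (1 : Mat n) i i * A j k = n * A j k := by
      simp
    have e4 : ∑ i, Q i j * g p i k = A j k := by
      have := congrFun (congrFun hQg j) k
      rw [← this]; rfl
    rw [e1, e2, e3, e4]; ring
  have hQ : (g p)⁻¹ * A = Q := by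
    rw [← hA, Matrix.nonsing_inv_mul_cancel_left _ _ hu]
  have hS : scalarCurv g p = 2 * ((n : ℝ) - 1) * Q.trace := by
    unfold scalarCurv
    have tr : ∀ B : Mat n, Bᵀ = B → ∑ j, ∑ k, (g p)⁻¹ j k * B j k = ((g p)⁻¹ * B).trace := by
      intro B hB
      unfold Matrix.trace
      refine Finset.sum_congr rfl fun j _ => ?_
      rw [Matrix.diag_apply, Matrix.mul_apply]
      refine Finset.sum_congr rfl fun k _ => ?_
      rw [← congrFun (congrFun hB k) j]; rfl
    have : ∀ j k, (g p)⁻¹ j k * ricci g j k p = ((n : ℝ) - 2) * ((g p)⁻¹ j k * A j k)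
        + Q.trace * ((g p)⁻¹ j k * g p j k) := by
      intro j k; rw [hric]; ring
    simp only [this, Finset.sum_add_distrib, ← Finset.mul_sum]
    rw [tr A hAs, tr (g p) hgs, hQ, Matrix.nonsing_inv_mul _ hu, Matrix.trace_one, Fintype.card_fin]
    ring
  ext i j
  simp only [schouten, Matrix.smul_apply, Matrix.of_apply, hric, hS, smul_eq_mul]
  field_simp
  ring

theorem curv_eq_curvM (d : FB n) (i j : Fin n) (p : Pt n) : d.curv i j p = curvM d.ω i j p := by
  ext a b
  simp only [FB.curv, curvM, Matrix.of_apply, Matrix.add_apply, Matrix.sub_apply,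
    Finset.sum_sub_distrib]
  rfl

theorem gauss_curvM (d : FB n) (hg : d.GaussEq) {p : Pt n} (hp : p ∈ d.U)
    (hsym : (d.h p)ᵀ = d.h p) (hdet : (d.h p).det ≠ 0) (i j : Fin n) :
    curvM d.ω i j p =
      (colM d.ζ i p * (colM d.ξ j p)ᵀ - colM d.ξ j p * (colM d.ζ i p)ᵀ
        + colM d.ξ i p * (colM d.ζ j p)ᵀ - colM d.ζ j p * (colM d.ξ i p)ᵀ) * d.h p := by
  have hu : IsUnit (d.h p).det := hdet.isUnit
  have hrow : ∀ (F : Pt n → Mat n) (i c : Fin n), ((F p)ᵀ * d.h p) i c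
      = ((colM F i p)ᵀ * d.h p) () c := fun F i c => rfl
  have hcol : ∀ (F : Pt n → Mat n) (i c : Fin n), ((F p)ᵀ * d.h p) i c
      = (d.h p * colM F i p) c () := by
    intro F i c
    have : d.h p * colM F i p = ((colM F i p)ᵀ * d.h p)ᵀ := by
      rw [Matrix.transpose_mul, hsym, Matrix.transpose_transpose]
    rw [this]; rfl
  have outer : ∀ (N : Matrix (Fin n) Unit ℝ) (N' : Matrix Unit (Fin n) ℝ) (c c' : Fin n),
      (d.h p * (N * N' * d.h p)) c c' = (d.h p * N) c () * (N' * d.h p) () c' := by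
    intro N N' c c'
    rw [Matrix.mul_assoc, ← Matrix.mul_assoc, Matrix.mul_apply]; simp
  have key : d.h p * curvM d.ω i j p = d.h p * ((colM d.ζ i p * (colM d.ξ j p)ᵀ
      - colM d.ξ j p * (colM d.ζ i p)ᵀ + colM d.ξ i p * (colM d.ζ j p)ᵀ
      - colM d.ζ j p * (colM d.ξ i p)ᵀ) * d.h p) := by
    ext c' c
    have h1 := hg p hp i j c c'
    have h2 : (∑ a, d.curv i j p a c * d.h p a c') = (d.h p * curvM d.ω i j p) c' c := by
      rw [Matrix.mul_apply]
      refine Finset.sum_congr rfl fun a _ => ?_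
      rw [curv_eq_curvM, mul_comm, ← congrFun (congrFun hsym a) c']; rfl
    rw [← h2, h1]
    rw [hrow d.ξ j c, hcol d.ζ i c', hcol d.ξ j c', hrow d.ζ i c, hrow d.ζ j c, hcol d.ξ i c',
      hcol d.ζ j c', hrow d.ξ i c]
    simp only [Matrix.mul_add, Matrix.mul_sub, Matrix.add_mul, Matrix.sub_mul, Matrix.add_apply,
      Matrix.sub_apply]
    simp only [outer]
    ring
  have := congrArg (fun N => (d.h p)⁻¹ * N) key
  simpa only [Matrix.nonsing_inv_mul_cancel_left _ _ hu] using this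

theorem statement6_aux {n : ℕ} (hn : 3 ≤ n) (d : Loc.FB n) (hfb : d.IsFB) (hgauss : d.GaussEq) :
    (∀ p ∈ d.ctb1.reg, (d.ctb1.gmet p).IsSymm ∧ (d.ctb1.gmet p).PosDef) ∧
    ConformallyFlatOn d.ctb1.gmet d.ctb1.reg ∧
    (∀ p ∈ d.ctb1.reg, schouten d.ctb1.gmet p = -(d.FF2 p)) ∧
    (∀ p ∈ d.ctb1.reg,
      d.FF3 p =
        schouten d.ctb1.gmet p * (d.ctb1.gmet p)⁻¹ * schouten d.ctb1.gmet p) := by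
  obtain ⟨⟨hU, hh, hpos, hω, hmet, hξ, hcoh⟩, ⟨-, -, -, -, -, hζ, hcoz⟩, hcomp⟩ := hfb
  simp only [FB.ctb1] at hU hh hpos hω hmet hξ hcoh
  simp only [FB.ctb2] at hζ hcoz
  have hg : d.ctb1.gmet = fun q => (d.ξ q)ᵀ * d.h q * d.ξ q := rfl
  set V := d.ctb1.reg with hVd
  have hVU : V ⊆ d.U := fun p hp => hp.1
  have hdetξ : ∀ p ∈ V, (d.ξ p).det ≠ 0 := fun p hp => hp.2
  have shU : SmM d.h d.U := hh
  have sξU : SmM d.ξ d.U := hξ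
  have sh : SmM d.h V := shU.mono hVU
  have sξ : SmM d.ξ V := sξU.mono hVU
  have sζ : SmM d.ζ V := SmM.mono hζ hVU
  have sω : ∀ i, SmM (d.ω i) V := fun i => SmM.mono (hω i) hVU
  have hV : IsOpen V :=
    (sm_det sξU).continuousOn.isOpen_inter_preimage hU isOpen_compl_singleton
  have hsym : ∀ p ∈ V, (d.h p)ᵀ = d.h p := fun p hp => (hpos p (hVU hp)).1
  have hdet : ∀ p ∈ V, (d.h p).det ≠ 0 := fun p hp => (hpos p (hVU hp)).2.det_pos.ne'
  have hmet' : ∀ p ∈ V, ∀ i, pdM i d.h p = (d.ω i p)ᵀ * d.h p + d.h p * d.ω i p := by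
    intro p hp i
    ext a b
    refine (hmet p (hVU hp) i a b).trans ?_
    rw [Matrix.add_apply, Matrix.mul_apply, Matrix.mul_apply]
    congr 1
    exact Finset.sum_congr rfl fun c _ => mul_comm _ _
  have hcoh1 : ∀ p ∈ V, ∀ a i j, (pdM i d.ξ p + d.ω i p * d.ξ p) a j
      = (pdM j d.ξ p + d.ω j p * d.ξ p) a i := fun p hp a i j => hcoh p (hVU hp) a i j
  have hcoh2 : ∀ p ∈ V, ∀ i j, pdM i (colM d.ξ j) p + d.ω i p * colM d.ξ j p
      = pdM j (colM d.ξ i) p + d.ω j p * colM d.ξ i p := by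
    intro p hp i j
    ext a b
    exact hcoh p (hVU hp) a i j
  have hcoz2 : ∀ p ∈ V, ∀ i j, pdM i (colM d.ζ j) p + d.ω i p * colM d.ζ j p
      = pdM j (colM d.ζ i) p + d.ω j p * colM d.ζ i p := by
    intro p hp i j
    ext a b
    exact hcoz p (hVU hp) a i j
  have hcomp2 : ∀ p ∈ V, ∀ i j, (colM d.ξ i p)ᵀ * d.h p * colM d.ζ j p
      = (colM d.ξ j p)ᵀ * d.h p * colM d.ζ i p := by
    intro p hp i j
    ext a b
    exact congrFun (congrFun (hcomp p (hVU hp)) j) i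
  have hG : ∀ p ∈ V, ∀ i j, curvM d.ω i j p =
      (colM d.ζ i p * (colM d.ξ j p)ᵀ - colM d.ξ j p * (colM d.ζ i p)ᵀ
        + colM d.ξ i p * (colM d.ζ j p)ᵀ - colM d.ζ j p * (colM d.ξ i p)ᵀ) * d.h p :=
    fun p hp i j => gauss_curvM d hgauss (hVU hp) (hsym p hp) (hdet p hp) i j
  have hgs : ∀ p ∈ V, ((d.ξ p)ᵀ * d.h p * d.ξ p)ᵀ = (d.ξ p)ᵀ * d.h p * d.ξ p := by
    intro p hp
    simp only [Matrix.transpose_mul, Matrix.transpose_transpose, hsym p hp, Matrix.mul_assoc]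
  have hsch : ∀ p ∈ V, schouten d.ctb1.gmet p = (d.ξ p)ᵀ * d.h p * d.ζ p := by
    intro p hp
    rw [hg]
    have uξ : IsUnit (d.ξ p).det := (hdetξ p hp).isUnit
    refine schouten_alg hn (Q := (d.ξ p)⁻¹ * d.ζ p) ?_ (hcomp p (hVU hp)) (hgs p hp) ?_ ?_
    · simp only [Matrix.mul_assoc, Matrix.mul_nonsing_inv_cancel_left _ _ uξ]
    · simp only [Matrix.det_mul, Matrix.det_transpose]
      exact (mul_ne_zero (mul_ne_zero (hdetξ p hp) (hdet p hp)) (hdetξ p hp)).isUnit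
    · intro l i j k
      rw [riemann_eq hV d.h d.ξ d.ω sh sξ sω hsym hdet hdetξ hmet' hcoh1 p hp, hG p hp]
      have outer : ∀ (N : Matrix (Fin n) Unit ℝ) (N' : Matrix Unit (Fin n) ℝ) (c c' : Fin n),
          ((d.ξ p)⁻¹ * (N * N' * d.h p) * d.ξ p) c c'
            = ((d.ξ p)⁻¹ * N) c () * (N' * (d.h p * d.ξ p)) () c' := by
        intro N N' c c'
        have : (d.ξ p)⁻¹ * (N * N' * d.h p) * d.ξ p
            = ((d.ξ p)⁻¹ * N) * (N' * (d.h p * d.ξ p)) := by simp only [Matrix.mul_assoc]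
        rw [this, Matrix.mul_apply]; simp
      have r1 : ∀ (F : Pt n → Mat n) i k, ((colM F i p)ᵀ * (d.h p * d.ξ p)) () k
          = ((F p)ᵀ * (d.h p * d.ξ p)) i k := fun F i k => rfl
      have r2 : ∀ (F : Pt n → Mat n) l i, ((d.ξ p)⁻¹ * colM F i p) l ()
          = ((d.ξ p)⁻¹ * F p) l i := fun F i k => rfl
      have r3 : (d.ζ p)ᵀ * (d.h p * d.ξ p) = (d.ξ p)ᵀ * d.h p * d.ζ p := by
        rw [← show ((d.ξ p)ᵀ * d.h p * d.ζ p)ᵀ = _ from hcomp p (hVU hp)]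
        simp only [Matrix.transpose_mul, Matrix.transpose_transpose, hsym p hp, Matrix.mul_assoc]
      have r4 : (d.ξ p)⁻¹ * d.ξ p = 1 := Matrix.nonsing_inv_mul _ uξ
      simp only [Matrix.mul_add, Matrix.mul_sub, Matrix.add_mul, Matrix.sub_mul, Matrix.add_apply,
        Matrix.sub_apply]
      simp only [outer, r1, r2, r3, r4, Matrix.mul_assoc (d.ξ p)ᵀ (d.h p) (d.ξ p)]
  refine ⟨?_, ?_, ?_, ?_⟩
  · intro p hp
    refine ⟨hgs p hp, ?_⟩
    have hinj : Function.Injective (d.ξ p).mulVec :=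
      Matrix.mulVec_injective_iff_isUnit.mpr
        ((Matrix.isUnit_iff_isUnit_det _).mpr (hdetξ p hp).isUnit)
    have := (hpos p (hVU hp)).2.conjTranspose_mul_mul_same hinj
    rwa [Matrix.conjTranspose_eq_transpose_of_trivial] at this
  · exact conf_flat_local hV sh sξ sζ sω hsym hdet hdetξ hmet' hcoh2 hcoz2 hcomp2 hG
  · intro p hp
    rw [hsch p hp, FB.FF2, neg_neg]
  · intro p hp
    rw [hsch p hp, hg]
    have uξ : IsUnit (d.ξ p).det := (hdetξ p hp).isUnit
    have uh : IsUnit (d.h p).det := (hdet p hp).isUnit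
    have uξt : IsUnit ((d.ξ p)ᵀ).det := by rw [Matrix.det_transpose]; exact uξ
    have hAs : (d.ξ p)ᵀ * d.h p * d.ζ p = (d.ζ p)ᵀ * d.h p * d.ξ p := by
      rw [← show ((d.ξ p)ᵀ * d.h p * d.ζ p)ᵀ = _ from hcomp p (hVU hp)]
      simp only [Matrix.transpose_mul, Matrix.transpose_transpose, hsym p hp, Matrix.mul_assoc]
    unfold FB.FF3
    conv_rhs =>
      enter [1, 1]
      rw [hAs]
    simp only [Matrix.mul_inv_rev, Matrix.mul_assoc, Matrix.mul_nonsing_inv_cancel_left _ _ uξ,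
      Matrix.nonsing_inv_mul_cancel_left _ _ uξt, Matrix.nonsing_inv_mul_cancel_left _ _ uh]

end main
end Loc
end

open Loc

/-- Lemma 9: let `(Mⁿ,E,⟨,⟩,D,ξ,ζ)` be a frontal bundle over a
1-connected manifold `Mⁿ` (`n ≥ 3`) satisfying the Gauss equation, and suppose the
regular set `R_M` of `ξ` is dense.  Then the first fundamental form `g = ξ*⟨,⟩` is a
conformally flat (Riemannian) metric on `R_M`, the Schouten tensor `A` of `g` equals
`-II` (i.e. `A = ξᵀ h ζ` in the trivialization), and the third fundamental form
`ǧ = ζ*⟨,⟩` satisfies `ǧ_{ij} = Σ_{a,b} A_{ia} g^{ab} A_{bj}`. -/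
theorem statement6 {n : ℕ} (hn : 3 ≤ n) (d : Loc.FB n) (hfb : d.IsFB)
    (hconn : IsConnected d.U) (hsc : SimplyConnectedSpace d.U)
    (hgauss : d.GaussEq) (hdense : d.U ⊆ closure d.ctb1.reg) :
    (∀ p ∈ d.ctb1.reg, (d.ctb1.gmet p).IsSymm ∧ (d.ctb1.gmet p).PosDef) ∧
    ConformallyFlatOn d.ctb1.gmet d.ctb1.reg ∧
    (∀ p ∈ d.ctb1.reg, schouten d.ctb1.gmet p = -(d.FF2 p)) ∧
    (∀ p ∈ d.ctb1.reg,
      d.FF3 p =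
        schouten d.ctb1.gmet p * (d.ctb1.gmet p)⁻¹ * schouten d.ctb1.gmet p) := by
  exact statement6_aux hn d hfb hgauss
end
end

section
/- For each n ≥ 4 there exists a spacelike front x: S² × S^{n−2} → Q^{n+1}_+ which is not an immersion; namely, the spacelike front induced from the generalized Clifford torus cannot be an immersion, since otherwise Kuiper's theorem would force the compact 1-connected manifold S² × S^{n−2} to be diffeomorphic to S^n. -/
open scoped Manifold

noncomputable section

/-- `x : Mⁿ → Q^{n+1}_+` is a spacelike frontal with dual `y : Mⁿ → Q^{n+1}_-`
(over an arbitrary model `I` for the manifold `M`). -/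
structure IsSpacelikeFrontalPair (n : ℕ) {EM : Type*} [NormedAddCommGroup EM]
    [NormedSpace ℝ EM] {HM : Type*} [TopologicalSpace HM] (I : ModelWithCorners ℝ EM HM)
    {M : Type*} [TopologicalSpace M] [ChartedSpace HM M]
    (x y : M → Fin (n + 2) → ℝ) : Prop where
  smooth_x : ContMDiff I 𝓘(ℝ, Fin (n + 2) → ℝ) (⊤ : ℕ∞) x
  smooth_y : ContMDiff I 𝓘(ℝ, Fin (n + 2) → ℝ) (⊤ : ℕ∞) y
  x_null : ∀ p, mink n (x p) (x p) = 0
  x_upper : ∀ p, 0 < x p 0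
  y_null : ∀ p, mink n (y p) (y p) = 0
  y_lower : ∀ p, y p 0 < 0
  pairing : ∀ p, mink n (x p) (y p) = 1
  dx_y : ∀ p (v : TangentSpace I p),
    mink n (mfderiv I 𝓘(ℝ, Fin (n + 2) → ℝ) x p v) (y p) = 0
  dy_x : ∀ p (v : TangentSpace I p),
    mink n (mfderiv I 𝓘(ℝ, Fin (n + 2) → ℝ) y p v) (x p) = 0

/-- The unit sphere `S^m ⊆ ℝ^{m+1}` as a smooth manifold. -/
abbrev Sph (m : ℕ) := Metric.sphere (0 : EuclideanSpace ℝ (Fin (m + 1))) 1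

/-- The basic map. -/
def FF (k : ℕ) (a b c d e : ℝ) (z : EuclideanSpace ℝ (Fin 3) × EuclideanSpace ℝ (Fin (k + 1))) :
    Fin (k + 2 + 2) → ℝ :=
  Fin.cons (a + b * z.2 0) (Fin.cons ((c + d * z.2 0) * z.1 0)
    (Fin.cons ((c + d * z.2 0) * z.1 1) (Fin.cons ((c + d * z.2 0) * z.1 2)
      (fun j : Fin k => e * z.2 j.succ))))

/-- Its derivative. -/
def DF (k : ℕ) (b c d e : ℝ) (z w : EuclideanSpace ℝ (Fin 3) × EuclideanSpace ℝ (Fin (k + 1))) :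
    Fin (k + 2 + 2) → ℝ :=
  Fin.cons (b * w.2 0) (Fin.cons ((c + d * z.2 0) * w.1 0 + d * w.2 0 * z.1 0)
    (Fin.cons ((c + d * z.2 0) * w.1 1 + d * w.2 0 * z.1 1)
      (Fin.cons ((c + d * z.2 0) * w.1 2 + d * w.2 0 * z.1 2)
      (fun j : Fin k => e * w.2 j.succ))))

lemma mink_cons (k : ℕ) (a b c d a' b' c' d' : ℝ) (f f' : Fin k → ℝ) :
    mink (k + 2) (Fin.cons a (Fin.cons b (Fin.cons c (Fin.cons d f))) : Fin (k + 4) → ℝ)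
      (Fin.cons a' (Fin.cons b' (Fin.cons c' (Fin.cons d' f'))) : Fin (k + 4) → ℝ) =
    - (a * a') + b * b' + c * c' + d * d' + ∑ j, f j * f' j := by
  unfold mink
  rw [Fin.sum_univ_succ, Fin.sum_univ_succ, Fin.sum_univ_succ, Fin.sum_univ_succ]
  simp only [Fin.cons_succ, Fin.cons_zero, Fin.succ_ne_zero, if_true, if_false]
  simp only [one_mul]
  ring

lemma FF_contDiff (k : ℕ) (a b c d e : ℝ) {m} : ContDiff ℝ m (FF k a b c d e) := by
  rw [contDiff_pi]
  intro i
  unfold FF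
  refine Fin.cases ?_ (fun i => ?_) i
  · simp only [Fin.cons_zero]; fun_prop
  refine Fin.cases ?_ (fun i => ?_) i
  · simp only [Fin.cons_succ, Fin.cons_zero]; fun_prop
  refine Fin.cases ?_ (fun i => ?_) i
  · simp only [Fin.cons_succ, Fin.cons_zero]; fun_prop
  refine Fin.cases ?_ (fun i => ?_) i
  · simp only [Fin.cons_succ, Fin.cons_zero]; fun_prop
  simp only [Fin.cons_succ]; fun_prop

lemma FF_fderiv (k : ℕ) (a b c d e : ℝ)
    (z w : EuclideanSpace ℝ (Fin 3) × EuclideanSpace ℝ (Fin (k + 1))) :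
    fderiv ℝ (FF k a b c d e) z w = DF k b c d e z w := by
  have h : DifferentiableAt ℝ (FF k a b c d e) z :=
    (FF_contDiff k a b c d e (m := 1)).differentiable (by simp) z
  have hl : HasDerivAt (fun t : ℝ => z + t • w) w 0 := by
    simpa using ((hasDerivAt_id (0:ℝ)).smul_const w).const_add z
  have h1 : HasDerivAt (fun t : ℝ => FF k a b c d e (z + t • w))
      (fderiv ℝ (FF k a b c d e) z w) 0 := by
    have h' : HasFDerivAt (FF k a b c d e) (fderiv ℝ (FF k a b c d e) z) (z + (0:ℝ) • w) := by
      simpa using h.hasFDerivAt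
    exact h'.comp_hasDerivAt 0 hl
  refine h1.unique ?_
  have key : ∀ u v α β γ δ : ℝ, HasDerivAt (fun t : ℝ => (α + β * (u + t * v)) * (γ + t * δ))
      ((α + β * u) * δ + β * v * γ) 0 := by
    intro u v α β γ δ
    have e1 : HasDerivAt (fun t : ℝ => α + β * (u + t * v)) (β * v) 0 := by
      simpa using ((((hasDerivAt_id (0:ℝ)).mul_const v).const_add u).const_mul β).const_add α
    have e2 : HasDerivAt (fun t : ℝ => γ + t * δ) δ 0 := by
      simpa using (((hasDerivAt_id (0:ℝ)).mul_const δ).const_add γ)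
    exact (e1.mul e2).congr_deriv (by ring)
  have key2 : ∀ u v α β : ℝ, HasDerivAt (fun t : ℝ => (α + β * (u + t * v)))
      (β * v) 0 := by
    intro u v α β
    simpa using ((((hasDerivAt_id (0:ℝ)).mul_const v).const_add u).const_mul β).const_add α
  rw [hasDerivAt_pi]
  intro i
  unfold FF DF
  refine Fin.cases ?_ (fun i => ?_) i
  · exact key2 _ _ _ _
  refine Fin.cases ?_ (fun i => ?_) i
  · exact key _ _ _ _ _ _
  refine Fin.cases ?_ (fun i => ?_) i
  · exact key _ _ _ _ _ _
  refine Fin.cases ?_ (fun i => ?_) i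
  · exact key _ _ _ _ _ _
  simp only [Fin.cons_succ]
  simpa using key2 (z.2 i.succ) (w.2 i.succ) 0 e

lemma sph_smooth (k : ℕ) {m} : ContMDiff (𝓡 k) 𝓘(ℝ, EuclideanSpace ℝ (Fin (k+1))) m
    (fun p : Sph k => (p : EuclideanSpace ℝ (Fin (k+1)))) := by
  have := Fact.mk (@finrank_euclideanSpace_fin ℝ _ (k + 1))
  exact contMDiff_coe_sphere (n := k)

/-- Differential of the inclusion of a sphere. -/
def dI (k : ℕ) (p : Sph k) : EuclideanSpace ℝ (Fin k) →L[ℝ] EuclideanSpace ℝ (Fin (k+1)) :=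
  mfderiv (𝓡 k) 𝓘(ℝ, EuclideanSpace ℝ (Fin (k+1)))
    (fun p : Sph k => (p : EuclideanSpace ℝ (Fin (k+1)))) p

lemma dI_range (k : ℕ) (p : Sph k) :
    (dI k p).range = (ℝ ∙ (p : EuclideanSpace ℝ (Fin (k+1))))ᗮ := by
  have := Fact.mk (@finrank_euclideanSpace_fin ℝ _ (k + 1))
  exact range_mfderiv_coe_sphere (n := k) p

lemma dI_inj (k : ℕ) (p : Sph k) : Function.Injective (dI k p) := by
  have := Fact.mk (@finrank_euclideanSpace_fin ℝ _ (k + 1))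
  exact mfderiv_coe_sphere_injective (n := k) p

lemma hasMF_prod {k : ℕ} {E F : Type*} [NormedAddCommGroup E] [NormedSpace ℝ E]
    [NormedAddCommGroup F] [NormedSpace ℝ F] {f : Sph 2 × Sph k → E} {g : Sph 2 × Sph k → F}
    {p : Sph 2 × Sph k}
    {f' : EuclideanSpace ℝ (Fin 2) × EuclideanSpace ℝ (Fin k) →L[ℝ] E}
    {g' : EuclideanSpace ℝ (Fin 2) × EuclideanSpace ℝ (Fin k) →L[ℝ] F}
    (hf : HasMFDerivAt ((𝓡 2).prod (𝓡 k)) 𝓘(ℝ, E) f p f')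
    (hg : HasMFDerivAt ((𝓡 2).prod (𝓡 k)) 𝓘(ℝ, F) g p g') :
    HasMFDerivAt ((𝓡 2).prod (𝓡 k)) 𝓘(ℝ, E × F) (fun q => (f q, g q)) p (f'.prod g') :=
  ⟨hf.1.prodMk hg.1, hf.2.prodMk hg.2⟩

/-- inclusion -/
def inc (k : ℕ) (p : Sph 2 × Sph k) : EuclideanSpace ℝ (Fin 3) × EuclideanSpace ℝ (Fin (k + 1)) :=
  ((p.1 : EuclideanSpace ℝ (Fin 3)), (p.2 : EuclideanSpace ℝ (Fin (k + 1))))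

lemma inc_smooth (k : ℕ) : ContMDiff ((𝓡 2).prod (𝓡 k))
    𝓘(ℝ, EuclideanSpace ℝ (Fin 3) × EuclideanSpace ℝ (Fin (k + 1))) (⊤ : ℕ∞) (inc k) := by
  have h1 : ContMDiff ((𝓡 2).prod (𝓡 k)) 𝓘(ℝ, EuclideanSpace ℝ (Fin 3)) (⊤ : ℕ∞)
      (fun p : Sph 2 × Sph k => (p.1 : EuclideanSpace ℝ (Fin 3))) :=
    (sph_smooth 2).comp contMDiff_fst
  have h2 : ContMDiff ((𝓡 2).prod (𝓡 k)) 𝓘(ℝ, EuclideanSpace ℝ (Fin (k+1))) (⊤ : ℕ∞)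
      (fun p : Sph 2 × Sph k => (p.2 : EuclideanSpace ℝ (Fin (k+1)))) :=
    (sph_smooth k).comp contMDiff_snd
  exact h1.prodMk_space h2

lemma inc_deriv (k : ℕ) (p : Sph 2 × Sph k) (v : EuclideanSpace ℝ (Fin 2) × EuclideanSpace ℝ (Fin k)) :
    mfderiv ((𝓡 2).prod (𝓡 k)) 𝓘(ℝ, EuclideanSpace ℝ (Fin 3) × EuclideanSpace ℝ (Fin (k + 1)))
      (inc k) p v =
    (dI 2 p.1 v.1,
      dI k p.2 v.2) := by
  have d1 : MDifferentiableAt (𝓡 2) 𝓘(ℝ, EuclideanSpace ℝ (Fin 3))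
      (fun p : Sph 2 => (p : EuclideanSpace ℝ (Fin 3))) p.1 :=
    (sph_smooth 2 (m := 1)).mdifferentiableAt (by simp)
  have d2 : MDifferentiableAt (𝓡 k) 𝓘(ℝ, EuclideanSpace ℝ (Fin (k+1)))
      (fun p : Sph k => (p : EuclideanSpace ℝ (Fin (k+1)))) p.2 :=
    (sph_smooth k (m := 1)).mdifferentiableAt (by simp)
  have h1 := d1.hasMFDerivAt.comp p (hasMFDerivAt_fst (I := 𝓡 2) (I' := 𝓡 k) p)
  have h2 := d2.hasMFDerivAt.comp p (hasMFDerivAt_snd (I := 𝓡 2) (I' := 𝓡 k) p)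
  have := (hasMF_prod h1 h2).mfderiv
  exact congrArg (fun L => L v) this

lemma FF_mfderiv (k : ℕ) (a b c d e : ℝ) (p : Sph 2 × Sph k)
    (v : EuclideanSpace ℝ (Fin 2) × EuclideanSpace ℝ (Fin k)) :
    mfderiv ((𝓡 2).prod (𝓡 k)) 𝓘(ℝ, Fin (k + 2 + 2) → ℝ) (fun q => FF k a b c d e (inc k q)) p v
      = DF k b c d e (inc k p) (dI 2 p.1 v.1,
      dI k p.2 v.2) := by
  have h := (((FF_contDiff k a b c d e (m := 1)).differentiable (by simp)
    (inc k p)).hasFDerivAt.hasMFDerivAt).comp p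
    (((inc_smooth k).mdifferentiableAt (by simp) (x := p)).hasMFDerivAt)
  have h' := congrArg (fun L => L v) h.mfderiv
  rw [← FF_fderiv k a]
  refine h'.trans ?_
  exact congrArg (fderiv ℝ (FF k a b c d e) (inc k p)) (inc_deriv k p v)

lemma FF_smooth (k : ℕ) (a b c d e : ℝ) : ContMDiff ((𝓡 2).prod (𝓡 k))
    𝓘(ℝ, Fin (k + 2 + 2) → ℝ) (⊤ : ℕ∞) (fun q => FF k a b c d e (inc k q)) :=
  (FF_contDiff k a b c d e).contMDiff.comp (inc_smooth k)

lemma sph_eq {k : ℕ} (p : Sph k) :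
    (p : EuclideanSpace ℝ (Fin (k+1))) 0 ^ 2 +
      ∑ j : Fin k, (p : EuclideanSpace ℝ (Fin (k+1))) j.succ ^ 2 = 1 := by
  have h : ‖(p : EuclideanSpace ℝ (Fin (k+1)))‖ ^ 2 = 1 := by simp
  rw [EuclideanSpace.norm_sq_eq, Fin.sum_univ_succ] at h
  simpa using h

lemma sph_tan {k : ℕ} (p : Sph k) (v : EuclideanSpace ℝ (Fin k))
    (w : EuclideanSpace ℝ (Fin (k+1))) (hw : w = dI k p v) :
    (p : EuclideanSpace ℝ (Fin (k+1))) 0 * w 0 +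
      ∑ j : Fin k, (p : EuclideanSpace ℝ (Fin (k+1))) j.succ * w j.succ = 0 := by
  have hm : w ∈ (ℝ ∙ (p : EuclideanSpace ℝ (Fin (k+1))))ᗮ := by
    rw [← dI_range k p, hw]
    exact ⟨v, rfl⟩
  rw [Submodule.mem_orthogonal_singleton_iff_inner_right, PiLp.inner_apply,
    Fin.sum_univ_succ] at hm
  simp only [RCLike.inner_apply, conj_trivial] at hm
  rw [← hm]
  congr 1
  · ring
  · exact Finset.sum_congr rfl fun j _ => by ring

lemma core (k : ℕ) (hk : 2 ≤ k) :
    ∃ x y : (Sph 2 × Sph k) → Fin (k + 2 + 2) → ℝ,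
      IsSpacelikeFrontalPair (k + 2) ((𝓡 2).prod (𝓡 k)) x y ∧
      (∀ p, Function.Injective
        (mfderiv ((𝓡 2).prod (𝓡 k)) 𝓘(ℝ, (Fin (k + 2 + 2) → ℝ) × (Fin (k + 2 + 2) → ℝ))
          (fun q => (x q, y q)) p)) ∧
      ¬ (∀ p, Function.Injective
        (mfderiv ((𝓡 2).prod (𝓡 k)) 𝓘(ℝ, Fin (k + 2 + 2) → ℝ) x p)) := by
  refine ⟨fun q => FF k (5/4) (3/4) (3/4) (5/4) 1 (inc k q),
    fun q => FF k (-5/8) (3/8) (-3/8) (5/8) (1/2) (inc k q), ?_, ?_, ?_⟩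
  · have hq0 : ∀ q : Sph k, (q : EuclideanSpace ℝ (Fin (k+1))) 0 ^ 2 ≤ 1 := by
      intro q
      have := sph_eq q
      have h2 : 0 ≤ ∑ j : Fin k, (q : EuclideanSpace ℝ (Fin (k+1))) j.succ ^ 2 :=
        Finset.sum_nonneg fun j _ => sq_nonneg _
      linarith
    have hS : ∀ (q : Sph k) (α β : ℝ), ∑ j : Fin k,
        (α * (q : EuclideanSpace ℝ (Fin (k+1))) j.succ) *
        (β * (q : EuclideanSpace ℝ (Fin (k+1))) j.succ) =
        α * β * (1 - (q : EuclideanSpace ℝ (Fin (k+1))) 0 ^ 2) := by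
      intro q α β
      rw [← sph_eq q, add_sub_cancel_left, Finset.mul_sum]
      exact Finset.sum_congr rfl fun j _ => by ring
    have hP : ∀ p : Sph 2, (p : EuclideanSpace ℝ (Fin 3)) 0 ^ 2 +
        ((p : EuclideanSpace ℝ (Fin 3)) 1 ^ 2 + (p : EuclideanSpace ℝ (Fin 3)) 2 ^ 2) = 1 := by
      intro p
      have := sph_eq p
      simpa [Fin.sum_univ_two] using this
    have hD : ∀ (p : Sph 2 × Sph k) (v : EuclideanSpace ℝ (Fin 2) × EuclideanSpace ℝ (Fin k))
        (a' b' c' d' e' b c d e : ℝ),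
        e' * e = d' * d - b' * b → d * c' = b * a' →
        mink (k + 2) (DF k b c d e (inc k p) (dI 2 p.1 v.1,
      dI k p.2 v.2))
          (FF k a' b' c' d' e' (inc k p)) = 0 := by
      intro p v a' b' c' d' e' b c d e H1 H2
      generalize hw1 : dI 2 p.1 v.1 = w1
      generalize hw2 : dI k p.2 v.2 = w2
      have t1 := sph_tan p.1 v.1 w1 hw1.symm
      have t2 := sph_tan p.2 v.2 w2 hw2.symm
      have t0 := hP p.1
      rw [Fin.sum_univ_two] at t1
      unfold DF FF
      refine (mink_cons k _ _ _ _ _ _ _ _ _ _).trans ?_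
      have t3 : ∑ j : Fin k, e * w2 j.succ * (e' * (p.2 : EuclideanSpace ℝ (Fin (k+1))) j.succ) =
          e' * e * ∑ j : Fin k, (p.2 : EuclideanSpace ℝ (Fin (k+1))) j.succ * w2 j.succ := by
        rw [Finset.mul_sum]
        exact Finset.sum_congr rfl fun j _ => by ring
      simp only [inc]
      rw [t3]
      rw [H1]
      generalize (∑ j : Fin k, (p.2 : EuclideanSpace ℝ (Fin (k+1))) j.succ * w2 j.succ) = S at *
      change (p.1 : EuclideanSpace ℝ (Fin 3)) 0 * w1 0 + ((p.1 : EuclideanSpace ℝ (Fin 3)) 1 * w1 1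
        + (p.1 : EuclideanSpace ℝ (Fin 3)) 2 * w1 2) = 0 at t1
      generalize (p.1 : EuclideanSpace ℝ (Fin 3)) 0 = p0 at *
      generalize (p.1 : EuclideanSpace ℝ (Fin 3)) 1 = p1 at *
      generalize (p.1 : EuclideanSpace ℝ (Fin 3)) 2 = p2 at *
      generalize (p.2 : EuclideanSpace ℝ (Fin (k+1))) 0 = q0 at *
      generalize w1 0 = r0 at *
      generalize w1 1 = r1 at *
      generalize w1 2 = r2 at *
      generalize w2 0 = s0 at *
      linear_combination (c + d * q0) * (c' + d' * q0) * t1 + (d' * d - b' * b) * t2 +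
        d * s0 * (c' + d' * q0) * t0 + s0 * H2
    refine ⟨FF_smooth _ _ _ _ _ _, FF_smooth _ _ _ _ _ _, ?_, ?_, ?_, ?_, ?_, ?_, ?_⟩
    · intro p
      unfold FF
      refine (mink_cons k _ _ _ _ _ _ _ _ _ _).trans ?_
      refine (congrArg _ (hS p.2 _ _)).trans ?_
      simp only [inc]
      linear_combination (3/4 + 5/4 * (p.2 : EuclideanSpace ℝ (Fin (k+1))) 0)^2 * hP p.1
    · intro p
      change 0 < 5/4 + 3/4 * (p.2 : EuclideanSpace ℝ (Fin (k+1))) 0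
      nlinarith [hq0 p.2]
    · intro p
      unfold FF
      refine (mink_cons k _ _ _ _ _ _ _ _ _ _).trans ?_
      refine (congrArg _ (hS p.2 _ _)).trans ?_
      simp only [inc]
      linear_combination (-3/8 + 5/8 * (p.2 : EuclideanSpace ℝ (Fin (k+1))) 0)^2 * hP p.1
    · intro p
      change -5/8 + 3/8 * (p.2 : EuclideanSpace ℝ (Fin (k+1))) 0 < 0
      nlinarith [hq0 p.2]
    · intro p
      unfold FF
      refine (mink_cons k _ _ _ _ _ _ _ _ _ _).trans ?_
      refine (congrArg _ (hS p.2 _ _)).trans ?_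
      simp only [inc]
      linear_combination (3/4 + 5/4 * (p.2 : EuclideanSpace ℝ (Fin (k+1))) 0) *
        (-3/8 + 5/8 * (p.2 : EuclideanSpace ℝ (Fin (k+1))) 0) * hP p.1
    · intro p v
      refine Eq.trans (congrArg (fun u => mink (k+2) u _) (FF_mfderiv k _ _ _ _ _ p v)) ?_
      exact hD p v _ _ _ _ _ _ _ _ _ (by norm_num) (by norm_num)
    · intro p v
      refine Eq.trans (congrArg (fun u => mink (k+2) u _) (FF_mfderiv k _ _ _ _ _ p v)) ?_
      exact hD p v _ _ _ _ _ _ _ _ _ (by norm_num) (by norm_num)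
  · intro p
    rw [injective_iff_map_eq_zero]
    intro v hv
    have hx := ((FF_smooth k (5/4) (3/4) (3/4) (5/4) 1).mdifferentiableAt
      (by simp) (x := p)).hasMFDerivAt
    have hy := ((FF_smooth k (-5/8) (3/8) (-3/8) (5/8) (1/2)).mdifferentiableAt
      (by simp) (x := p)).hasMFDerivAt
    have hxy := congrArg (fun L : EuclideanSpace ℝ (Fin 2) × EuclideanSpace ℝ (Fin k) →L[ℝ]
      (Fin (k + 2 + 2) → ℝ) × (Fin (k + 2 + 2) → ℝ) => L v) (hasMF_prod hx hy).mfderiv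
    have hv2 := hxy.symm.trans hv
    have e1 := (FF_mfderiv k (5/4) (3/4) (3/4) (5/4) 1 p v).symm.trans (congrArg Prod.fst hv2)
    have e2 := (FF_mfderiv k (-5/8) (3/8) (-3/8) (5/8) (1/2) p v).symm.trans
      (congrArg Prod.snd hv2)
    have i1 := dI_inj 2 p.1
    have i2 := dI_inj k p.2
    rw [injective_iff_map_eq_zero] at i1 i2
    suffices h : dI 2 p.1 v.1 = 0 ∧
        dI k p.2 v.2 = 0 from
      Prod.ext (i1 _ h.1) (i2 _ h.2)
    generalize dI 2 p.1 v.1 = w1 at *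
    generalize dI k p.2 v.2 = w2 at *
    have a0 : 3/4 * w2 0 = 0 := congrFun e1 0
    have w20 : w2 0 = 0 := by linarith
    have a1 : _ * w1 0 + _ * w2 0 * _ = 0 := congrFun e1 (Fin.succ 0)
    have a2 : _ * w1 1 + _ * w2 0 * _ = 0 := congrFun e1 (Fin.succ (Fin.succ 0))
    have a3 : _ * w1 2 + _ * w2 0 * _ = 0 := congrFun e1 (Fin.succ (Fin.succ (Fin.succ 0)))
    have b1 : _ * w1 0 + _ * w2 0 * _ = 0 := congrFun e2 (Fin.succ 0)
    have b2 : _ * w1 1 + _ * w2 0 * _ = 0 := congrFun e2 (Fin.succ (Fin.succ 0))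
    have b3 : _ * w1 2 + _ * w2 0 * _ = 0 := congrFun e2 (Fin.succ (Fin.succ (Fin.succ 0)))
    rw [w20] at a1 a2 a3 b1 b2 b3
    have c1 : w1 0 = 0 := by linarith
    have c2 : w1 1 = 0 := by linarith
    have c3 : w1 2 = 0 := by linarith
    constructor
    · ext i
      fin_cases i
      · exact c1
      · exact c2
      · exact c3
    · ext i
      refine Fin.cases w20 (fun j => ?_) i
      have : 1 * w2 j.succ = 0 := congrFun e1 (Fin.succ (Fin.succ (Fin.succ (Fin.succ j))))
      simpa using this
  · intro H
    obtain ⟨m, rfl⟩ : ∃ m, k = m + 1 := ⟨k - 1, by omega⟩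
    let q : EuclideanSpace ℝ (Fin (m + 1 + 1)) :=
      WithLp.toLp 2 (Fin.cons (-3/5) (Fin.cons (4/5) (fun _ => 0)))
    have hq : q ∈ Metric.sphere (0 : EuclideanSpace ℝ (Fin (m + 1 + 1))) 1 := by
      rw [mem_sphere_zero_iff_norm, ← sq_eq_sq₀ (norm_nonneg _) zero_le_one,
        EuclideanSpace.norm_sq_eq, Fin.sum_univ_succ, Fin.sum_univ_succ]
      simp [q]
      norm_num
    let p0 : Sph 2 := ⟨EuclideanSpace.single 0 1, by simp⟩
    let p : Sph 2 × Sph (m + 1) := (p0, ⟨q, hq⟩)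
    let v1 : EuclideanSpace ℝ (Fin 2) := EuclideanSpace.single 0 1
    let v : TangentSpace ((𝓡 2).prod (𝓡 (m+1))) p := (v1, (0 : EuclideanSpace ℝ (Fin (m+1))))
    have hi := H p
    rw [injective_iff_map_eq_zero] at hi
    have hv : v = 0 := by
      apply hi
      refine (FF_mfderiv (m+1) _ _ _ _ _ p v).trans ?_
      have hz : dI (m+1) p.2 v.2 = 0 :=
        map_zero _
      rw [hz]
      generalize dI 2 p.1 v.1 = w1
      have q0 : (inc (m+1) p).2 0 = -3/5 := rfl
      unfold DF
      rw [q0]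
      change (Fin.cons (3/4 * (0:ℝ)) (Fin.cons ((3/4 + 5/4 * (-3/5)) * w1 0 + 5/4 * (0:ℝ) * _)
        (Fin.cons ((3/4 + 5/4 * (-3/5)) * w1 1 + 5/4 * (0:ℝ) * _)
        (Fin.cons ((3/4 + 5/4 * (-3/5)) * w1 2 + 5/4 * (0:ℝ) * _)
        (fun _ => 1 * (0:ℝ))))) : Fin (m + 1 + 4) → ℝ) = 0
      funext i
      refine Fin.cases ?_ (fun i => ?_) i
      · simp
      refine Fin.cases ?_ (fun i => ?_) i
      · simp only [Fin.cons_succ, Fin.cons_zero, Pi.zero_apply]; ring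
      refine Fin.cases ?_ (fun i => ?_) i
      · simp only [Fin.cons_succ, Fin.cons_zero, Pi.zero_apply]; ring
      refine Fin.cases ?_ (fun i => ?_) i
      · simp only [Fin.cons_succ, Fin.cons_zero, Pi.zero_apply]; ring
      simp
    have h1 : v1 = 0 := congrArg Prod.fst hv
    have h2 := congrFun (congrArg WithLp.ofLp h1) 0
    simp [v1] at h2

/-- for each `n ≥ 4` there is a spacelike front
`x : S² × S^{n-2} → Q^{n+1}_+` (i.e. a spacelike frontal `x` with dual `y` such that the
pair `(x,y)` is an immersion) which is not an immersion. -/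
theorem statement10 (n : ℕ) (hn : 4 ≤ n) :
    ∃ x y : (Sph 2 × Sph (n - 2)) → Fin (n + 2) → ℝ,
      IsSpacelikeFrontalPair n ((𝓡 2).prod (𝓡 (n - 2))) x y ∧
      (∀ p, Function.Injective
        (mfderiv ((𝓡 2).prod (𝓡 (n - 2))) 𝓘(ℝ, (Fin (n + 2) → ℝ) × (Fin (n + 2) → ℝ))
          (fun q => (x q, y q)) p)) ∧
      ¬ (∀ p, Function.Injective
        (mfderiv ((𝓡 2).prod (𝓡 (n - 2))) 𝓘(ℝ, Fin (n + 2) → ℝ) x p)) := by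
  obtain ⟨k, rfl⟩ : ∃ k, n = k + 2 := ⟨n - 2, by omega⟩
  exact core k (by omega)
end
end

section
/- Let (M², g) be a flat Riemannian 2-manifold and II a traceless Codazzi tensor on (M², g). Then the metric ǧ defined by ǧ = Σ_{i,j,a,b} II_{ia} II_{jb} g^{ab} du^i ⊗ du^j is also flat on the regular set of ǧ (the set where ǧ is non-degenerate), and II is a traceless Codazzi tensor with respect to ǧ on that set. -/
noncomputable section

open Loc

/-- Covariant derivative `(∇A)(∂ᵢ;∂ⱼ,∂ₖ) = ∂ᵢA_{jk} - Γ^m_{ij}A_{mk} - Γ^m_{ik}A_{jm}`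
of a symmetric 2-tensor `A` with respect to the Levi-Civita connection of `g`. -/
def covDerT {n : ℕ} (g A : Loc.Pt n → Loc.Mat n) (i j k : Fin n) (p : Loc.Pt n) : ℝ :=
  pd i (fun q => A q j k) p - (∑ m, christoffel g m i j p * A p m k)
    - ∑ m, christoffel g m i k p * A p j m

namespace S14

open Matrix

/-- Entrywise smoothness on a set. -/
def Sm {n : ℕ} (A : Pt n → Mat n) (V : Set (Pt n)) : Prop :=
  ∀ i j, ContDiffOn ℝ (⊤ : ℕ∞) (fun p => A p i j) V

/-- Entrywise partial derivative of a matrix function. -/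
def dM {n : ℕ} (i : Fin n) (A : Pt n → Mat n) (p : Pt n) : Mat n :=
  Matrix.of fun a b => pd i (fun q => A q a b) p

/-- Connection matrices of a metric. -/
def G {n : ℕ} (g : Pt n → Mat n) (i : Fin n) (p : Pt n) : Mat n :=
  Matrix.of fun k j => christoffel g k i j p

variable {n : ℕ} {V : Set (Pt n)} {p : Pt n}

lemma pd_congr (hV : IsOpen V) (hp : p ∈ V) {f h : Pt n → ℝ} (e : ∀ q ∈ V, f q = h q)
    (i : Fin n) : pd i f p = pd i h p := by
  unfold pd
  rw [Filter.EventuallyEq.fderiv_eq (Filter.eventuallyEq_of_mem (hV.mem_nhds hp) e)]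

lemma pd_smooth (hV : IsOpen V) {f : Pt n → ℝ} (hf : ContDiffOn ℝ (⊤ : ℕ∞) f V) (i : Fin n) :
    ContDiffOn ℝ (⊤ : ℕ∞) (pd i f) V := by
  have := hf.fderiv_of_isOpen (m := (⊤ : ℕ∞)) hV (by simp)
  exact this.clm_apply contDiffOn_const

lemma pd_comm (hV : IsOpen V) (hp : p ∈ V) {f : Pt n → ℝ}
    (hf : ContDiffOn ℝ (⊤ : ℕ∞) f V) (i j : Fin n) :
    pd i (pd j f) p = pd j (pd i f) p := by
  have hs : IsSymmSndFDerivAt ℝ f p :=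
    (hf.contDiffAt (hV.mem_nhds hp)).isSymmSndFDerivAt (by simpa using (WithTop.coe_le_coe.2 le_top : ((2 : ℕ∞) : WithTop ℕ∞) ≤ ((⊤ : ℕ∞) : WithTop ℕ∞)))
  have hd : DifferentiableAt ℝ (fderiv ℝ f) p :=
    ((hf.fderiv_of_isOpen (m := (⊤ : ℕ∞)) hV (by simp)).contDiffAt
      (hV.mem_nhds hp)).differentiableAt (by simp)
  have key : ∀ i j : Fin n, pd i (pd j f) p =
      fderiv ℝ (fderiv ℝ f) p (Pi.single i 1) (Pi.single j 1) := by
    intro i j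
    change fderiv ℝ (fun q => fderiv ℝ f q (Pi.single j 1)) p (Pi.single i 1) = _
    rw [fderiv_clm_apply hd (differentiableAt_const _)]
    simp
  rw [key, key]
  exact hs _ _

lemma Sm.diff (hV : IsOpen V) (hp : p ∈ V) {A : Pt n → Mat n} (hA : Sm A V) (a b : Fin n) :
    DifferentiableAt ℝ (fun q => A q a b) p :=
  ((hA a b).contDiffAt (hV.mem_nhds hp)).differentiableAt (by simp)

lemma Sm.mul {A B : Pt n → Mat n} (hA : Sm A V) (hB : Sm B V) : Sm (fun q => A q * B q) V := by
  intro i j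
  simp only [Matrix.mul_apply]
  exact ContDiffOn.sum fun k _ => (hA i k).mul (hB k j)

lemma Sm.add {A B : Pt n → Mat n} (hA : Sm A V) (hB : Sm B V) : Sm (fun q => A q + B q) V :=
  fun i j => (hA i j).add (hB i j)

lemma Sm.dM (hV : IsOpen V) {A : Pt n → Mat n} (hA : Sm A V) (i : Fin n) : Sm (dM i A) V :=
  fun a b => pd_smooth hV (hA a b) i

lemma Sm.congr {A B : Pt n → Mat n} (hA : Sm A V) (e : ∀ q ∈ V, B q = A q) : Sm B V :=
  fun i j => (hA i j).congr fun q hq => by rw [e q hq]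

lemma dM_congr (hV : IsOpen V) (hp : p ∈ V) {A B : Pt n → Mat n} (e : ∀ q ∈ V, A q = B q)
    (i : Fin n) : dM i A p = dM i B p := by
  ext a b
  exact pd_congr hV hp (fun q hq => by rw [e q hq]) i

lemma dM_mul (hV : IsOpen V) (hp : p ∈ V) {A B : Pt n → Mat n} (hA : Sm A V) (hB : Sm B V)
    (i : Fin n) : dM i (fun q => A q * B q) p = dM i A p * B p + A p * dM i B p := by
  ext a b
  simp only [dM, Matrix.of_apply, Matrix.add_apply, Matrix.mul_apply, pd]
  have hd : ∀ k ∈ (Finset.univ : Finset (Fin n)),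
      DifferentiableAt ℝ (fun q => A q a k * B q k b) p :=
    fun k _ => (hA.diff hV hp a k).mul (hB.diff hV hp k b)
  rw [fderiv_fun_sum hd, ContinuousLinearMap.sum_apply, ← Finset.sum_add_distrib]
  refine Finset.sum_congr rfl fun k _ => ?_
  rw [fderiv_fun_mul (hA.diff hV hp a k) (hB.diff hV hp k b)]
  simp
  ring

lemma dM_add (hV : IsOpen V) (hp : p ∈ V) {A B : Pt n → Mat n} (hA : Sm A V) (hB : Sm B V)
    (i : Fin n) : dM i (fun q => A q + B q) p = dM i A p + dM i B p := by
  ext a b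
  simp only [dM, Matrix.of_apply, Matrix.add_apply, pd]
  rw [fderiv_fun_add (hA.diff hV hp a b) (hB.diff hV hp a b)]
  simp

lemma dM_comm (hV : IsOpen V) (hp : p ∈ V) {A : Pt n → Mat n} (hA : Sm A V) (i j : Fin n) :
    dM i (dM j A) p = dM j (dM i A) p := by
  ext a b
  exact pd_comm hV hp (hA a b) i j

lemma dM_transpose (A : Pt n → Mat n) (i : Fin n) :
    dM i (fun q => (A q)ᵀ) p = (dM i A p)ᵀ := rfl

lemma dM_symm (hV : IsOpen V) (hp : p ∈ V) {A : Pt n → Mat n} (e : ∀ q ∈ V, (A q)ᵀ = A q)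
    (i : Fin n) : (dM i A p)ᵀ = dM i A p := by
  rw [← dM_transpose]
  exact dM_congr hV hp e i

/-- `g Γ_i` in terms of derivatives. -/
lemma g_mul_G {g : Pt n → Mat n} (hdet : IsUnit (g p).det) (i l j : Fin n) :
    (g p * G g i p) l j = (1 / 2) * (dM i g p j l + dM j g p i l - dM l g p i j) := by
  have : G g i p = (g p)⁻¹ * Matrix.of (fun l j =>
      (1 / 2) * (dM i g p j l + dM j g p i l - dM l g p i j)) := by
    ext k j
    simp only [G, christoffel, Matrix.of_apply, Matrix.mul_apply, Finset.mul_sum, dM]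
    exact Finset.sum_congr rfl fun _ _ => by ring
  rw [this, Matrix.mul_nonsing_inv_cancel_left _ _ hdet]
  rfl

lemma G_symm (hV : IsOpen V) (hp : p ∈ V) {g : Pt n → Mat n} (e : ∀ q ∈ V, (g q)ᵀ = g q)
    (i j k : Fin n) : G g i p k j = G g j p k i := by
  have h : ∀ l a b, dM l g p a b = dM l g p b a := fun l a b =>
    congrFun (congrFun (dM_symm hV hp e l).symm a) b
  simp only [dM, Matrix.of_apply] at h
  simp only [G, christoffel, Matrix.of_apply]
  congr 1
  refine Finset.sum_congr rfl fun l _ => ?_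
  rw [h l j i]
  ring

lemma G_metric (hV : IsOpen V) (hp : p ∈ V) {g : Pt n → Mat n} (e : ∀ q ∈ V, (g q)ᵀ = g q)
    (hdet : IsUnit (g p).det) (i : Fin n) :
    dM i g p = (G g i p)ᵀ * g p + g p * G g i p := by
  have h : ∀ l a b, dM l g p a b = dM l g p b a := fun l a b =>
    congrFun (congrFun (dM_symm hV hp e l).symm a) b
  have h1 : (G g i p)ᵀ * g p = (g p * G g i p)ᵀ := by rw [Matrix.transpose_mul, e p hp]
  rw [h1]
  ext a b
  rw [Matrix.add_apply, Matrix.transpose_apply, g_mul_G hdet, g_mul_G hdet,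
    h b i a, h a i b, h i b a]
  ring

/-- Uniqueness of the Levi-Civita connection. -/
lemma G_unique {g : Pt n → Mat n} (hs : (g p)ᵀ = g p) (hdet : IsUnit (g p).det)
    (C : Fin n → Mat n) (hC : ∀ i j k, C i k j = C j k i)
    (hm : ∀ i, dM i g p = (C i)ᵀ * g p + g p * C i) (i : Fin n) : G g i p = C i := by
  have h2 : g p * G g i p = g p * C i := by
    ext l j
    have hsym : ∀ a b, g p a b = g p b a := fun a b => congrFun (congrFun hs b) a
    have hc : ∀ i a b, dM i g p a b = (g p * C i) b a + (g p * C i) a b := by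
      intro i a b
      have : (C i)ᵀ * g p = (g p * C i)ᵀ := by rw [Matrix.transpose_mul, hs]
      rw [hm i, this]; rfl
    have hx : ∀ i j l, (g p * C i) l j = (g p * C j) l i := by
      intro i j l
      simp only [Matrix.mul_apply]
      exact Finset.sum_congr rfl fun m _ => by rw [hC]
    rw [g_mul_G hdet, hc, hc, hc, hx j i l, hx i l j, hx j l i]
    ring
  have := congrArg (fun M => (g p)⁻¹ * M) h2
  simpa [Matrix.nonsing_inv_mul_cancel_left _ _ hdet] using this

lemma riemann_eq (g : Pt n → Mat n) (l i j k : Fin n) :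
    riemann g l i j k p = (dM i (G g j) p - dM j (G g i) p
      + (G g i p * G g j p - G g j p * G g i p)) l k := by
  simp only [riemann, Matrix.add_apply, Matrix.sub_apply, Matrix.mul_apply,
    ← Finset.sum_sub_distrib]
  rfl

lemma covDerT_eq (g A : Pt n → Mat n) (i j k : Fin n) :
    covDerT g A i j k p = dM i A p j k - ((G g i p)ᵀ * A p) j k - (A p * G g i p) j k := by
  simp only [covDerT, Matrix.mul_apply, dM, G, Matrix.of_apply, Matrix.transpose_apply]
  congr 1
  exact Finset.sum_congr rfl fun _ _ => mul_comm _ _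

lemma Sm.G (hV : IsOpen V) {g : Pt n → Mat n} (hg : Sm g V) (hi : Sm (fun q => (g q)⁻¹) V)
    (i : Fin n) : Sm (G g i) V := by
  intro k j
  refine contDiffOn_const.mul (ContDiffOn.sum fun l _ => (hi k l).mul ?_)
  exact ((pd_smooth hV (hg j l) i).add (pd_smooth hV (hg i l) j)).sub
    (pd_smooth hV (hg i j) l)

lemma Sm.det2 {V : Set (Pt 2)} {g : Pt 2 → Mat 2} (hg : Sm g V) :
    ContDiffOn ℝ (⊤ : ℕ∞) (fun q => (g q).det) V := by
  simp only [Matrix.det_fin_two]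
  exact ((hg 0 0).mul (hg 1 1)).sub ((hg 0 1).mul (hg 1 0))

lemma Sm.inv2 {V : Set (Pt 2)} {g : Pt 2 → Mat 2} (hg : Sm g V) (hd : ∀ q ∈ V, (g q).det ≠ 0) :
    Sm (fun q => (g q)⁻¹) V := by
  have h := hg.det2.inv hd
  intro i j
  simp only [Matrix.inv_def, Ring.inverse_eq_inv', Matrix.adjugate_fin_two, Matrix.smul_apply,
    smul_eq_mul]
  refine h.mul ?_
  fin_cases i <;> fin_cases j <;> simp
  · exact hg 1 1
  · exact (hg 0 1).neg
  · exact (hg 1 0).neg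
  · exact hg 0 0

/-- The core: everything except positivity and the trace, on an open set. -/
lemma core (hV : IsOpen V) {g A : Pt n → Mat n} (hg : Sm g V) (hA : Sm A V)
    (hgi : Sm (fun q => (g q)⁻¹) V) (hAi : Sm (fun q => (A q)⁻¹) V)
    (sg : ∀ q ∈ V, (g q)ᵀ = g q) (sA : ∀ q ∈ V, (A q)ᵀ = A q)
    (ug : ∀ q ∈ V, IsUnit (g q).det) (uA : ∀ q ∈ V, IsUnit (A q).det)
    (hf : FlatOn g V)
    (hc : ∀ p ∈ V, ∀ i j k, covDerT g A i j k p = covDerT g A j i k p) :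
    FlatOn (fun q => A q * (g q)⁻¹ * A q) V ∧
    ∀ p ∈ V, ∀ i j k, covDerT (fun q => A q * (g q)⁻¹ * A q) A i j k p =
        covDerT (fun q => A q * (g q)⁻¹ * A q) A j i k p := by
  set gc : Pt n → Mat n := fun q => A q * (g q)⁻¹ * A q with hgc
  set S : Pt n → Mat n := fun q => (g q)⁻¹ * A q with hS
  set T : Pt n → Mat n := fun q => (A q)⁻¹ * g q with hT
  have sS : Sm S V := hgi.mul hA
  have sT : Sm T V := hAi.mul hg
  have gS : ∀ q ∈ V, g q * S q = A q := fun q hq =>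
    Matrix.mul_nonsing_inv_cancel_left _ _ (ug q hq)
  have AT : ∀ q ∈ V, A q * T q = g q := fun q hq =>
    Matrix.mul_nonsing_inv_cancel_left _ _ (uA q hq)
  have ST : ∀ q ∈ V, S q * T q = 1 := fun q hq => by
    rw [hS]; simp only
    rw [Matrix.mul_assoc, AT q hq, Matrix.nonsing_inv_mul _ (ug q hq)]
  have gcS : ∀ q, gc q = A q * S q := fun q => Matrix.mul_assoc _ _ _
  have StG : ∀ q ∈ V, (S q)ᵀ * g q = A q := fun q hq => by
    have := congrArg Matrix.transpose (gS q hq)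
    rwa [Matrix.transpose_mul, sg q hq, sA q hq] at this
  have sgc : ∀ q ∈ V, (gc q)ᵀ = gc q := fun q hq => by
    simp only [hgc, Matrix.transpose_mul, Matrix.transpose_nonsing_inv, sA q hq, sg q hq,
      Matrix.mul_assoc]
  have ugc : ∀ q ∈ V, IsUnit (gc q).det := fun q hq => by
    simp only [hgc, Matrix.det_mul]
    exact ((uA q hq).mul (Matrix.isUnit_nonsing_inv_det _ (ug q hq))).mul (uA q hq)
  have dA : ∀ q ∈ V, ∀ i, dM i A q = dM i g q * S q + g q * dM i S q := fun q hq i => by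
    rw [← dM_mul hV hq hg sS]
    exact dM_congr hV hq (fun q hq => (gS q hq).symm) i
  have met : ∀ q ∈ V, ∀ i, dM i g q = (G g i q)ᵀ * g q + g q * G g i q := fun q hq i =>
    G_metric hV hq sg (ug q hq) i
  -- the dual connection
  set C : Fin n → Pt n → Mat n := fun i q => T q * (dM i S q + G g i q * S q) with hC
  have gX : ∀ q ∈ V, ∀ i, g q * (dM i S q + G g i q * S q) = dM i A q - (G g i q)ᵀ * A q := by
    intro q hq i
    rw [dA q hq, met q hq, ← gS q hq]
    noncomm_ring
  have AC : ∀ q ∈ V, ∀ i, A q * C i q = dM i A q - (G g i q)ᵀ * A q := by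
    intro q hq i
    rw [hC, ← gX q hq]; simp only
    rw [← Matrix.mul_assoc, AT q hq]
  have SC : ∀ q ∈ V, ∀ i, S q * C i q = dM i S q + G g i q * S q := by
    intro q hq i
    rw [hC]; simp only
    rw [← Matrix.mul_assoc, ST q hq, Matrix.one_mul]
  have ACsym : ∀ q ∈ V, ∀ i m j, (A q * C i q) m j = (A q * C j q) m i := by
    intro q hq i m j
    rw [AC q hq, AC q hq]
    have hsw : ∀ i j k, covDerT g A i j k q = covDerT g A i k j q := by
      intro i j k
      have h1 := congrFun (congrFun (dM_symm hV hq sA i) j) k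
      have h2 : ∀ j k, ((G g i q)ᵀ * A q) j k = (A q * G g i q) k j := by
        intro j k
        have : (G g i q)ᵀ * A q = (A q * G g i q)ᵀ := by rw [Matrix.transpose_mul, sA q hq]
        rw [this]; rfl
      rw [covDerT_eq, covDerT_eq, h2, h2, ← h1, Matrix.transpose_apply]
      ring
    have h3 : covDerT g A i m j q = covDerT g A j m i q := by
      rw [hsw i m j, hc q hq, hsw j i m]
    have h4 : (A q * G g i q) m j = (A q * G g j q) m i := by
      simp only [Matrix.mul_apply]
      exact Finset.sum_congr rfl fun l _ => by rw [G_symm hV hq sg]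
    rw [covDerT_eq, covDerT_eq, h4] at h3
    simp only [Matrix.sub_apply]
    linarith
  have Csym : ∀ q ∈ V, ∀ i j k, C i q k j = C j q k i := by
    intro q hq i j k
    have h : ∀ i, C i q = (A q)⁻¹ * (A q * C i q) := fun i =>
      (Matrix.nonsing_inv_mul_cancel_left _ _ (uA q hq)).symm
    rw [h i, h j, Matrix.mul_apply, Matrix.mul_apply]
    exact Finset.sum_congr rfl fun m _ => by rw [ACsym q hq]
  have Cmet : ∀ q ∈ V, ∀ i, dM i gc q = (C i q)ᵀ * gc q + gc q * C i q := by
    intro q hq i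
    have h1 : dM i gc q = dM i A q * S q + A q * dM i S q := by
      rw [← dM_mul hV hq hA sS]
      exact dM_congr hV hq (fun q _ => gcS q) i
    have h2 : gc q * C i q = A q * (dM i S q + G g i q * S q) := by
      rw [gcS, Matrix.mul_assoc, SC q hq]
    have h3 : (C i q)ᵀ * gc q = (dM i A q - A q * G g i q) * S q := by
      have : (C i q)ᵀ * A q = dM i A q - A q * G g i q := by
        have := congrArg Matrix.transpose (AC q hq i)
        rwa [Matrix.transpose_mul (A q) (C i q), sA q hq, Matrix.transpose_sub,
          Matrix.transpose_mul (G g i q)ᵀ (A q),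
          Matrix.transpose_transpose, sA q hq, dM_symm hV hq sA] at this
      rw [gcS, ← Matrix.mul_assoc, this]
    rw [h1, h2, h3]
    noncomm_ring
  have GC : ∀ q ∈ V, ∀ i, G gc i q = C i q := fun q hq i =>
    G_unique (sgc q hq) (ugc q hq) (fun i => C i q) (Csym q hq) (Cmet q hq) i
  have sG : ∀ i, Sm (G g i) V := fun i => Sm.G hV hg hgi i
  have sC : ∀ i, Sm (C i) V := fun i => sT.mul ((sS.dM hV i).add ((sG i).mul sS))
  refine ⟨?_, ?_⟩
  · intro p hp l i j k
    rw [riemann_eq, dM_congr hV hp (fun q hq => GC q hq j), dM_congr hV hp (fun q hq => GC q hq i),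
      GC p hp, GC p hp]
    have hR : dM i (G g j) p - dM j (G g i) p
        + (G g i p * G g j p - G g j p * G g i p) = 0 := by
      ext l k
      rw [← riemann_eq]
      exact hf p hp l i j k
    have hD : ∀ i j, dM i S p * C j p + S p * dM i (C j) p
        = dM i (dM j S) p + (dM i (G g j) p * S p + G g j p * dM i S p) := by
      intro i j
      rw [← dM_mul hV hp sS (sC j), dM_congr hV hp (fun q hq => SC q hq j),
        dM_add hV hp (sS.dM hV j) ((sG j).mul sS), dM_mul hV hp (sG j) sS]
    have hD' : ∀ i j, S p * dM i (C j) p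
        = dM i (dM j S) p + (dM i (G g j) p * S p + G g j p * dM i S p) - dM i S p * C j p :=
      fun i j => by rw [← hD]; abel
    have hQ : ∀ i j, S p * (C i p * C j p) = dM i S p * C j p
        + G g i p * (dM j S p + G g j p * S p) := by
      intro i j
      rw [← Matrix.mul_assoc, SC p hp, Matrix.add_mul, Matrix.mul_assoc, SC p hp]
    have hZ : S p * (dM i (C j) p - dM j (C i) p + (C i p * C j p - C j p * C i p)) = 0 := by
      have : S p * (dM i (C j) p - dM j (C i) p + (C i p * C j p - C j p * C i p))
        = (dM i (G g j) p - dM j (G g i) p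
          + (G g i p * G g j p - G g j p * G g i p)) * S p := by
        rw [Matrix.mul_add, Matrix.mul_sub, Matrix.mul_sub, hD', hD', hQ, hQ,
          dM_comm hV hp sS i j]
        noncomm_ring
      rw [this, hR, Matrix.zero_mul]
    have TS : T p * S p = 1 := mul_eq_one_comm.mp (ST p hp)
    have hW := congrArg (fun M => T p * M) hZ
    simp only [← Matrix.mul_assoc (T p), TS, Matrix.one_mul, Matrix.mul_zero] at hW
    rw [hW]; rfl
  · intro p hp i j k
    have h : ∀ i j k, covDerT gc A i j k p
        = ((G g i p)ᵀ * A p) j k - ((C i p)ᵀ * A p) j k := by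
      intro i j k
      rw [covDerT_eq, GC p hp, AC p hp, Matrix.sub_apply]
      ring
    rw [h, h]
    simp only [Matrix.mul_apply, Matrix.transpose_apply]
    congr 1
    · exact Finset.sum_congr rfl fun m _ => by rw [G_symm hV hp sg]
    · exact Finset.sum_congr rfl fun m _ => by rw [Csym p hp]

end S14

/-- let `(M²,g)` be a flat Riemannian 2-manifold and `II` a traceless
Codazzi tensor on `(M²,g)`.  Then the metric
`ǧ = Σ_{i,j,a,b} II_{ia} II_{jb} g^{ab} du^i ⊗ du^j` is also flat on the regular set of
`ǧ` (where `ǧ` is non-degenerate, and where it is a Riemannian metric), and `II` is a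
traceless Codazzi tensor with respect to `ǧ` on that set. -/
theorem statement14 (U : Set (Loc.Pt 2)) (hU : IsOpen U)
    (g II : Loc.Pt 2 → Loc.Mat 2)
    (hgsmooth : ∀ i j, ContDiffOn ℝ (⊤ : ℕ∞) (fun p => g p i j) U)
    (hgmetric : ∀ p ∈ U, (g p).IsSymm ∧ (g p).PosDef)
    (hgflat : FlatOn g U)
    (hIIsmooth : ∀ i j, ContDiffOn ℝ (⊤ : ℕ∞) (fun p => II p i j) U)
    (hIIsymm : ∀ p ∈ U, (II p).IsSymm)
    (hcodazzi : ∀ p ∈ U, ∀ i j k, covDerT g II i j k p = covDerT g II j i k p)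
    (htraceless : ∀ p ∈ U, Matrix.trace ((g p)⁻¹ * II p) = 0) :
    (∀ p ∈ {q | q ∈ U ∧ (II q * (g q)⁻¹ * II q).det ≠ 0},
      (II p * (g p)⁻¹ * II p).IsSymm ∧ (II p * (g p)⁻¹ * II p).PosDef) ∧
    FlatOn (fun q => II q * (g q)⁻¹ * II q)
      {q | q ∈ U ∧ (II q * (g q)⁻¹ * II q).det ≠ 0} ∧
    (∀ p ∈ {q | q ∈ U ∧ (II q * (g q)⁻¹ * II q).det ≠ 0}, ∀ i j k,
      covDerT (fun q => II q * (g q)⁻¹ * II q) II i j k p =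
        covDerT (fun q => II q * (g q)⁻¹ * II q) II j i k p) ∧
    (∀ p ∈ {q | q ∈ U ∧ (II q * (g q)⁻¹ * II q).det ≠ 0},
      Matrix.trace ((II p * (g p)⁻¹ * II p)⁻¹ * II p) = 0) := by
  have key : ∀ q ∈ U, (II q * (g q)⁻¹ * II q).det ≠ 0 → (II q).det ≠ 0 := by
    intro q _ h h0
    apply h
    rw [Matrix.det_mul, h0, mul_zero]
  have ugU : ∀ q ∈ U, (g q).det ≠ 0 := fun q hq => (hgmetric q hq).2.det_pos.ne'
  have hgi : S14.Sm (fun q => (g q)⁻¹) U := S14.Sm.inv2 hgsmooth ugU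
  have hVo : IsOpen {q | q ∈ U ∧ (II q * (g q)⁻¹ * II q).det ≠ 0} := by
    have hcont : ContinuousOn (fun q => (II q * (g q)⁻¹ * II q).det) U :=
      (S14.Sm.det2 (S14.Sm.mul (S14.Sm.mul hIIsmooth hgi) hIIsmooth)).continuousOn
    exact hcont.isOpen_inter_preimage hU isOpen_compl_singleton
  set V : Set (Loc.Pt 2) := {q | q ∈ U ∧ (II q * (g q)⁻¹ * II q).det ≠ 0} with hV
  have hVU : V ⊆ U := fun q hq => hq.1
  have hdII : ∀ q ∈ V, (II q).det ≠ 0 := fun q hq => key q hq.1 hq.2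
  have sII : S14.Sm II V := fun i j => (hIIsmooth i j).mono hVU
  have c := S14.core hVo (g := g) (A := II) (fun i j => (hgsmooth i j).mono hVU) sII
    (fun i j => (hgi i j).mono hVU) (S14.Sm.inv2 sII hdII)
    (fun q hq => (hgmetric q hq.1).1) (fun q hq => hIIsymm q hq.1)
    (fun q hq => (ugU q hq.1).isUnit) (fun q hq => (hdII q hq).isUnit)
    (fun q hq => hgflat q hq.1) (fun q hq => hcodazzi q hq.1)
  refine ⟨?_, c.1, c.2, ?_⟩
  · intro p hp
    have hs : (II p).transpose = II p := hIIsymm p hp.1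
    have hpd : (II p * (g p)⁻¹ * II p).PosDef := by
      have hH : (II p).conjTranspose = II p := by
        rw [Matrix.conjTranspose_eq_transpose_of_trivial, hs]
      have hinj : Function.Injective (II p).mulVec :=
        Matrix.mulVec_injective_iff_isUnit.mpr
          ((Matrix.isUnit_iff_isUnit_det _).mpr (hdII p hp).isUnit)
      have := (hgmetric p hp.1).2.inv.conjTranspose_mul_mul_same hinj
      rwa [hH] at this
    refine ⟨?_, hpd⟩
    have := hpd.1
    rwa [Matrix.IsHermitian, Matrix.conjTranspose_eq_transpose_of_trivial] at this
  · intro p hp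
    have uA : IsUnit (II p).det := (hdII p hp).isUnit
    have e : (II p * (g p)⁻¹ * II p)⁻¹ * II p = ((g p)⁻¹ * II p)⁻¹ := by
      rw [Matrix.mul_assoc, Matrix.mul_inv_rev, Matrix.mul_assoc, Matrix.nonsing_inv_mul _ uA,
        Matrix.mul_one]
    have ht := htraceless p hp.1
    rw [e, Matrix.inv_def, Matrix.trace_smul, Matrix.adjugate_fin_two]
    rw [Matrix.trace_fin_two] at ht ⊢
    simp only [Matrix.of_apply, Matrix.cons_val_zero, Matrix.cons_val_one, Matrix.cons_val']
    rw [add_comm] at ht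
    simp [ht]
end
end
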